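/- arXiv:2407.10454 — 11 statements merged into one kernel-verified Lean document; each statement's English description precedes it below -/
import Mathlib

section
/- Let A be an n×n complex matrix whose characteristic polynomial over ℂ factors as ∏_{i=1}^n (X − λ_i) with the eigenvalues ordered so that |λ_1| ≥ |λ_2| ≥ … ≥ |λ_n|, and let s < n. Suppose u_1,…,u_s ∈ ℂ^n are linearly independent right eigenvectors (A u_i = λ_i u_i) and v_1,…,v_s ∈ ℂ^n are left eigenvectors (v_iᴴ A = λ_i v_iᴴ) scaled so that v_iᴴ u_i = 1 and v_iᴴ u_j = 0 for all 1 ≤ i ≠ j ≤ s. Then the deflated matrix A − E_s, where E_s = ∑_{i=1}^s λ_i u_i v_iᴴ, has spectral radius equal to |λ_{s+1}| (Hotelling's deflation). -/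
open Matrix Polynomial

/-- If `(A - E) * E = 0`, the characteristic polynomials of `A - E` and `E` multiply to that of `A`,
up to a power of `X`. -/
theorem Matrix.charpoly_sub_mul_charpoly {R m : Type*} [CommRing R] [Fintype m] [DecidableEq m]
    {A E : Matrix m m R} (h : (A - E) * E = 0) :
    (A - E).charpoly * E.charpoly = X ^ Fintype.card m * A.charpoly := by
  have key : (A - E).charmatrix * E.charmatrix = (X : R[X]) • A.charmatrix := by
    have hmap : (C.mapMatrix A - C.mapMatrix E) * C.mapMatrix E = (0 : Matrix m m R[X]) := by
      rw [← map_sub, ← map_mul, h, map_zero]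
    simp only [charmatrix, map_sub, ← smul_one_eq_diagonal, scalar_apply]
    rw [sub_mul, mul_sub, mul_sub, hmap]
    simp only [smul_mul_assoc, mul_smul_comm, one_mul, mul_one, smul_sub]
    abel
  rw [charpoly, charpoly, ← det_mul, key, det_smul, charpoly]

/-- Deflating by `U * D * W`, where the columns of `U` are right eigenvectors with eigenvalues `d` and
`W` is a left inverse of `U`, replaces the eigenvalues `d` by zeros. -/
theorem Matrix.charpoly_sub_mul_prod {R m k : Type*} [CommRing R] [Nontrivial R]
    [Fintype m] [DecidableEq m] [Fintype k] [DecidableEq k]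
    {A : Matrix m m R} {U : Matrix m k R} {W : Matrix k m R} {d : k → R}
    (hU : A * U = U * diagonal d) (hWU : W * U = 1) :
    (A - U * diagonal d * W).charpoly * ∏ i, (X - C (d i)) =
      X ^ Fintype.card k * A.charpoly := by
  have hzero : (A - U * diagonal d * W) * (U * diagonal d * W) = 0 := by
    rw [sub_mul, sub_eq_zero]
    calc A * (U * diagonal d * W) = A * U * diagonal d * W := by simp only [Matrix.mul_assoc]
      _ = U * diagonal d * (W * U) * diagonal d * W := by rw [hU, hWU, Matrix.mul_one]
      _ = _ := by simp only [Matrix.mul_assoc]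
  have h₁ := charpoly_sub_mul_charpoly hzero
  have h₂ := charpoly_mul_comm' U (diagonal d * W)
  rw [Matrix.mul_assoc, hWU, Matrix.mul_one, charpoly_diagonal, ← Matrix.mul_assoc] at h₂
  apply (isRegular_X_pow (R := R) (Fintype.card m)).left
  linear_combination
    X ^ Fintype.card k * h₁ - (A - U * diagonal d * W).charpoly * h₂

/-- **Hotelling's deflation.** If `A` has characteristic polynomial `∏ (X - λᵢ)` with
eigenvalues ordered by decreasing magnitude, and `u₁,…,u_s` (resp. `v₁,…,v_s`) are
biorthogonal right (resp. left) eigenvectors for the top `s` eigenvalues, then the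
deflated matrix `A - Eₛ` with `Eₛ = ∑ λᵢ uᵢ vᵢᴴ` has spectral radius `|λ_{s+1}|`. -/
theorem hotelling_deflation {n : ℕ} (A : Matrix (Fin n) (Fin n) ℂ)
    (lam : Fin n → ℂ)
    (hchar : A.charpoly = ∏ i : Fin n, (X - C (lam i)))
    (hord : ∀ i j : Fin n, i ≤ j → ‖lam j‖ ≤ ‖lam i‖)
    (s : ℕ) (hs : s < n)
    (u v : Fin s → Fin n → ℂ)
    (hu_indep : LinearIndependent ℂ u)
    (hu : ∀ i : Fin s, A.mulVec (u i) = lam (Fin.castLE hs.le i) • u i)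
    (hv : ∀ i : Fin s, Matrix.vecMul (star (v i)) A = lam (Fin.castLE hs.le i) • star (v i))
    (hbi : ∀ i j : Fin s, star (v i) ⬝ᵥ u j = if i = j then 1 else 0)
    (E : Matrix (Fin n) (Fin n) ℂ)
    (hE : E = ∑ i : Fin s, lam (Fin.castLE hs.le i) • vecMulVec (u i) (star (v i))) :
    spectralRadius ℂ (A - E) = (‖lam ⟨s, hs⟩‖₊ : ENNReal) := by
  set d : Fin s → ℂ := fun i => lam (Fin.castLE hs.le i) with hd
  have hU : A * (of u)ᵀ = (of u)ᵀ * diagonal d := by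
    ext i j
    have := congrFun (hu j) i
    rw [mul_diagonal]
    simpa [Matrix.mul_apply, mulVec, dotProduct, mul_comm, hd] using this
  have hWU : of (fun i => star (v i)) * (of u)ᵀ = 1 := by
    ext i j
    simpa [Matrix.mul_apply, dotProduct, one_apply] using hbi i j
  have hE' : E = (of u)ᵀ * diagonal d * of fun i => star (v i) := by
    ext i j
    rw [hE, Matrix.mul_apply, Matrix.sum_apply]
    simp only [mul_diagonal, Matrix.smul_apply, vecMulVec_apply, smul_eq_mul, transpose_apply,
      of_apply, hd]
    exact Finset.sum_congr rfl fun _ _ => by ring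
  have hdefl := charpoly_sub_mul_prod hU hWU
  obtain ⟨r, rfl⟩ := Nat.exists_eq_add_of_le hs.le
  rw [← hE', hchar, Fin.prod_univ_add, Fintype.card_fin] at hdefl
  have hprod : (∏ i, (X - C (d i))) ≠ 0 := (monic_prod_X_sub_C d Finset.univ).ne_zero
  have hcp : (A - E).charpoly = X ^ s * ∏ i : Fin r, (X - C (lam (Fin.natAdd s i))) := by
    apply mul_right_cancel₀ hprod
    rw [hdefl, mul_assoc, mul_comm (∏ i : Fin r, _)]
    rfl
  apply le_antisymm
  · refine iSup₂_le fun z hz => ?_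
    rw [mem_spectrum_iff_isRoot_charpoly, hcp, IsRoot.def, eval_mul, eval_prod, mul_eq_zero,
      Finset.prod_eq_zero_iff] at hz
    rcases hz with hz | ⟨i, -, hi⟩
    · have : z = 0 := by
        rw [eval_pow, eval_X] at hz
        exact eq_zero_of_pow_eq_zero hz
      simp [this]
    · have : z = lam (Fin.natAdd s i) := by simpa [sub_eq_zero] using hi
      rw [this]
      exact_mod_cast hord ⟨s, hs⟩ (Fin.natAdd s i) (by simp [Fin.le_def])
  · refine le_iSup₂ (f := fun z (_ : z ∈ spectrum ℂ (A - E)) => (‖z‖₊ : ENNReal))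
      (lam ⟨s, hs⟩) ?_
    rw [mem_spectrum_iff_isRoot_charpoly, hcp, IsRoot.def, eval_mul, eval_prod]
    refine mul_eq_zero_of_right _
      (Finset.prod_eq_zero (Finset.mem_univ (⟨0, by lia⟩ : Fin r)) ?_)
    simp [Fin.natAdd]
end

section
/- Let A be an n×n complex matrix, let λ_1,…,λ_s ∈ ℂ and u_1,…,u_s ∈ ℂ^n satisfy A u_i = λ_i u_i, and let v_1,…,v_s ∈ ℂ^n satisfy v_iᴴ u_i = 1 and v_iᴴ u_j = 0 for all 1 ≤ i ≠ j ≤ s. Set E_s = ∑_{i=1}^s λ_i u_i v_iᴴ. Then (A − E_s) E_s = 0, and consequently, for any α, γ ∈ ℂ with α γ λ_i ≠ 1 for all i = 1,…,s, one has (A − E_s)(I − α γ E_s)^{−1} = A − E_s. -/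
open Matrix

/-- Weighted sums of the rank-one projections `uᵢ vᵢᴴ` of a biorthogonal pair of families
multiply weightwise. -/
theorem sum_smul_vecMulVec_mul_sum_smul_vecMulVec {ι m R : Type*} [Fintype ι] [DecidableEq ι]
    [Fintype m] [CommRing R] (u w : ι → m → R)
    (hbi : ∀ i j, w i ⬝ᵥ u j = if i = j then 1 else 0) (a b : ι → R) :
    (∑ i, a i • vecMulVec (u i) (w i)) * (∑ i, b i • vecMulVec (u i) (w i)) =
      ∑ i, (a i * b i) • vecMulVec (u i) (w i) := by
  have hmul (i j) : vecMulVec (u i) (w i) * vecMulVec (u j) (w j) =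
      if i = j then vecMulVec (u i) (w j) else 0 := by
    rw [vecMulVec_mul_vecMulVec, hbi]
    split_ifs <;> simp
  simp [Finset.sum_mul, Finset.mul_sum, hmul, smul_smul, mul_comm]

/-- If no weight equals `1`, then `1 - ∑ aᵢ uᵢ vᵢᴴ` is invertible. -/
theorem isUnit_one_sub_sum_smul_vecMulVec {ι m K : Type*} [Fintype ι] [DecidableEq ι]
    [Fintype m] [DecidableEq m] [Field K] (u w : ι → m → K)
    (hbi : ∀ i j, w i ⬝ᵥ u j = if i = j then 1 else 0) (a : ι → K) (ha : ∀ i, a i ≠ 1) :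
    IsUnit (1 - ∑ i, a i • vecMulVec (u i) (w i)) := by
  refine IsUnit.of_mul_eq_one (1 + ∑ i, (a i / (1 - a i)) • vecMulVec (u i) (w i)) ?_
  rw [sub_mul, one_mul, mul_add, mul_one, sum_smul_vecMulVec_mul_sum_smul_vecMulVec u w hbi,
    ← Finset.sum_add_distrib, add_sub_assoc, ← Finset.sum_sub_distrib, add_eq_left]
  refine Finset.sum_eq_zero fun i _ => ?_
  have h : 1 - a i ≠ 0 := sub_ne_zero.mpr (ha i).symm
  rw [← add_smul, ← sub_smul]
  convert zero_smul K _
  field_simp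
  ring

/-- If `A uᵢ = λᵢ uᵢ`, the families `u`, `v` are biorthogonal (`vᵢᴴ uⱼ = δᵢⱼ`) and
`Eₛ = ∑ λᵢ uᵢ vᵢᴴ`, then `(A - Eₛ) Eₛ = 0`, and consequently for any `α, γ` with
`αγλᵢ ≠ 1` for all `i`, `(A - Eₛ)(I - αγEₛ)⁻¹ = A - Eₛ`. -/
theorem deflated_annihilates_deflation {n s : ℕ} (A : Matrix (Fin n) (Fin n) ℂ)
    (lam : Fin s → ℂ) (u v : Fin s → Fin n → ℂ)
    (hu : ∀ i : Fin s, A.mulVec (u i) = lam i • u i)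
    (hbi : ∀ i j : Fin s, star (v i) ⬝ᵥ u j = if i = j then 1 else 0)
    (E : Matrix (Fin n) (Fin n) ℂ)
    (hE : E = ∑ i : Fin s, lam i • vecMulVec (u i) (star (v i))) :
    (A - E) * E = 0 ∧
      ∀ α γ : ℂ, (∀ i : Fin s, α * γ * lam i ≠ 1) →
        (A - E) * (1 - (α * γ) • E)⁻¹ = A - E := by
  have hAE : (A - E) * E = 0 := by
    rw [sub_mul, sub_eq_zero]
    subst hE
    rw [sum_smul_vecMulVec_mul_sum_smul_vecMulVec u (fun i => star (v i)) hbi, Finset.mul_sum]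
    simp [mul_vecMulVec, hu, smul_vecMulVec, smul_smul]
  refine ⟨hAE, fun α γ h => ?_⟩
  have hunit : IsUnit (1 - (α * γ) • E) := by
    simpa only [hE, Finset.smul_sum, smul_smul] using
      isUnit_one_sub_sum_smul_vecMulVec u (fun i => star (v i)) hbi (fun i => α * γ * lam i) h
  have hfix : (A - E) * (1 - (α * γ) • E) = A - E := by
    rw [mul_sub, mul_one, mul_smul_comm, hAE, smul_zero, sub_zero]
  nth_rewrite 1 [← hfix]
  exact mul_nonsing_inv_cancel_right _ _ ((isUnit_iff_isUnit_det _).mp hunit)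
end

section
/- Let P be an n×n complex matrix with Schur decomposition P = U R Uᴴ, where U is unitary with columns u_1,…,u_n and R is upper triangular with diagonal entries λ_1,…,λ_n. Let s < n, set E_s = ∑_{i=1}^s λ_i u_i u_iᴴ, and let α, γ ∈ ℂ satisfy α γ λ_i ≠ 1 for i = 1,…,s (so that I − α γ E_s is invertible). Then the characteristic polynomial of the DDVI iteration matrix M = (1−α)(I − αγE_s)^{−1} + αγ(P − E_s)(I − αγE_s)^{−1} equals ∏_{i=1}^s (X − (1−α)/(1 − αγλ_i)) · ∏_{j=s+1}^n (X − (1 − α + αγλ_j)); in particular the eigenvalues of M are (1−α)/(1−αγλ_1),…,(1−α)/(1−αγλ_s), 1−α+αγλ_{s+1},…,1−α+αγλ_n. -/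
open Matrix Polynomial

/-- The partial sum `∑_{i<s} dᵢ uᵢ uᵢᴴ` over the columns of `U` is `U D Uᴴ` for the diagonal
matrix `D` that truncates `d` after the first `s` entries. -/
theorem sum_smul_vecMulVec_castLE {K : Type*} [CommSemiring K] [StarRing K] {m n s : ℕ}
    (hs : s ≤ n) (U : Matrix (Fin m) (Fin n) K) (d : Fin n → K) :
    ∑ i : Fin s, d (Fin.castLE hs i) •
        vecMulVec (fun x => U x (Fin.castLE hs i)) (star fun x => U x (Fin.castLE hs i)) =
      U * diagonal (fun i : Fin n => if (i : ℕ) < s then d i else 0) * Uᴴ := by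
  ext x y
  obtain ⟨k, rfl⟩ := Nat.exists_eq_add_of_le hs
  rw [Matrix.mul_apply]
  simp only [Matrix.sum_apply, Matrix.smul_apply, vecMulVec_apply, Pi.star_apply, smul_eq_mul,
    mul_diagonal, conjTranspose_apply, Fin.sum_univ_add]
  simp only [Fin.val_castAdd, Fin.is_lt, if_true, Fin.val_natAdd, add_lt_iff_neg_left,
    not_lt_zero, if_false, mul_zero, zero_mul, Finset.sum_const_zero, add_zero]
  refine Finset.sum_congr rfl fun i _ => ?_
  rw [show Fin.castLE hs i = Fin.castAdd k i from rfl]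
  ring

/-- Characteristic polynomial of the DDVI iteration matrix. With a Schur decomposition
`P = U R Uᴴ`, the Schur deflation matrix `Eₛ = ∑_{i<s} λᵢ uᵢ uᵢᴴ`, and
`M = (1-α)(I-αγEₛ)⁻¹ + αγ(P-Eₛ)(I-αγEₛ)⁻¹`, the characteristic polynomial of `M` is
`∏_{i<s}(X - (1-α)/(1-αγλᵢ)) ∏_{j≥s}(X - (1-α+αγλⱼ))`. -/
theorem ddvi_iteration_matrix_charpoly {n : ℕ} (P U R : Matrix (Fin n) (Fin n) ℂ)
    (hU : U ∈ Matrix.unitaryGroup (Fin n) ℂ)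
    (hR : R.BlockTriangular id)
    (hP : P = U * R * Uᴴ)
    (s : ℕ) (hs : s < n)
    (α γ : ℂ)
    (hαγ : ∀ i : Fin s, α * γ * R (Fin.castLE hs.le i) (Fin.castLE hs.le i) ≠ 1)
    (E M : Matrix (Fin n) (Fin n) ℂ)
    (hE : E = ∑ i : Fin s, R (Fin.castLE hs.le i) (Fin.castLE hs.le i) •
        vecMulVec (fun x => U x (Fin.castLE hs.le i)) (star fun x => U x (Fin.castLE hs.le i)))
    (hM : M = (1 - α) • (1 - (α * γ) • E)⁻¹ + (α * γ) • ((P - E) * (1 - (α * γ) • E)⁻¹)) :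
    M.charpoly = ∏ i : Fin n,
      (X - C (if (i : ℕ) < s then (1 - α) / (1 - α * γ * R i i)
              else 1 - α + α * γ * R i i)) := by
  have hUU : Uᴴ * U = 1 := mem_unitaryGroup_iff'.mp hU
  have hUU' : U * Uᴴ = 1 := mem_unitaryGroup_iff.mp hU
  have conj_mul (A B : Matrix (Fin n) (Fin n) ℂ) :
      U * A * Uᴴ * (U * B * Uᴴ) = U * (A * B) * Uᴴ := by
    rw [show U * A * Uᴴ * (U * B * Uᴴ) = U * A * (Uᴴ * U) * B * Uᴴ by noncomm_ring, hUU]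
    noncomm_ring
  let d : Fin n → ℂ := fun i => if (i : ℕ) < s then R i i else 0
  have hd (i : Fin n) : 1 - α * γ * d i ≠ 0 := by
    by_cases h : (i : ℕ) < s
    · simpa [d, h, sub_ne_zero] using (hαγ ⟨i, h⟩).symm
    · simp [d, h]
  have hE' : E = U * diagonal d * Uᴴ :=
    hE.trans (sum_smul_vecMulVec_castLE hs.le U fun i => R i i)
  let D : Matrix (Fin n) (Fin n) ℂ := diagonal fun i => (1 - α * γ * d i)⁻¹
  have h_sub : 1 - (α * γ) • E = U * diagonal (fun i => 1 - α * γ * d i) * Uᴴ := by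
    have : diagonal (fun i => 1 - α * γ * d i) = 1 - (α * γ) • diagonal d := by
      rw [← diagonal_one, ← diagonal_smul, diagonal_sub]
      rfl
    rw [this, hE', mul_sub, sub_mul, mul_one, hUU', mul_smul_comm, smul_mul_assoc]
  have h_inv : (1 - (α * γ) • E)⁻¹ = U * D * Uᴴ := by
    refine inv_eq_right_inv ?_
    rw [h_sub, conj_mul, diagonal_mul_diagonal]
    simp [hd, hUU']
  have hM' : M = U * ((1 - α) • D + (α * γ) • ((R - diagonal d) * D)) * Uᴴ := by
    rw [hM, h_inv, hP, hE', ← sub_mul, ← mul_sub, conj_mul, mul_add, add_mul]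
    simp only [mul_smul_comm, smul_mul_assoc]
  have hT : ((1 - α) • D + (α * γ) • ((R - diagonal d) * D)).BlockTriangular id := by
    have hD : D.BlockTriangular id := blockTriangular_diagonal _
    have hRD : ((R - diagonal d) * D).BlockTriangular id :=
      (hR.sub (blockTriangular_diagonal d)).mul hD
    intro i j hij
    simp [hD hij, hRD hij]
  rw [hM', charpoly_mul_comm, ← mul_assoc, hUU, one_mul, charpoly_of_isUpperTriangular _ hT]
  refine Finset.prod_congr rfl fun i _ => ?_
  congr 2
  by_cases h : (i : ℕ) < s <;> simp [D, d, h, div_eq_mul_inv]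
end

section
/- Let P be an n×n row-stochastic real matrix, regarded as a complex matrix, whose characteristic polynomial factors as ∏_{i=1}^n (X − λ_i) with |λ_1| ≥ … ≥ |λ_n|, let γ ∈ [0,1), r ∈ ℂ^n, and V^π = (I − γP)^{−1} r. Let s < n, let u_1,…,u_s ∈ ℂ^n satisfy P u_i = λ_i u_i, let v_1,…,v_s ∈ ℂ^n satisfy v_iᴴ u_i = 1 and v_iᴴ u_j = 0 for i ≠ j, and set E_s = ∑_{i=1}^s λ_i u_i v_iᴴ. Fix α ∈ (0,1] and define the DDVI iterates by V^{k+1} = (I − αγE_s)^{−1}( α r + ((1−α)I + αγ(P − E_s)) V^k ) for k ≥ 0, starting from any V^0 ∈ ℂ^n. Let λ = max over 1 ≤ i ≤ s and s+1 ≤ j ≤ n of { |(1−α)/(1 − αγλ_i)| , |1 − α + αγλ_j| }. Then for every ε > 0 there exists a constant C ≥ 0 such that ‖V^k − V^π‖_∞ ≤ C (λ + ε)^k ‖V^0 − V^π‖_∞ for all k ≥ 0. -/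
open Matrix Polynomial

/-- If the characteristic polynomial splits with roots `l i`, then so does the determinant of every
pencil `a - b M`. -/
lemma det_smul_one_sub_smul_of_charpoly_eq_prod {ι K : Type*} [Fintype ι] [DecidableEq ι] [Field K]
    {M : Matrix ι ι K} {l : ι → K} (h : M.charpoly = ∏ i, (X - C (l i))) (a b : K) :
    (a • (1 : Matrix ι ι K) - b • M).det = ∏ i, (a - b * l i) := by
  rcases eq_or_ne b 0 with rfl | hb
  · simp
  · have hfac : a • (1 : Matrix ι ι K) - b • M = b • (Matrix.scalar ι (a / b) - M) := by
      rw [smul_sub, Matrix.scalar_apply, ← Matrix.smul_one_eq_diagonal, smul_smul,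
        mul_div_cancel₀ _ hb]
    rw [hfac, Matrix.det_smul, ← Matrix.eval_charpoly, h, Polynomial.eval_prod,
      ← Finset.card_univ, ← Finset.prod_const, ← Finset.prod_mul_distrib]
    refine Finset.prod_congr rfl fun i _ => ?_
    simp only [eval_sub, eval_X, eval_C]
    field_simp

/-- Two matrices which act on a common invariant subspace (the range of `U`) through commuting
matrices `F` and `G`, and which agree on the complement `ker W`, have determinants in the ratio
`det F : det G`. -/
lemma det_mul_det_eq_of_eq_on_compl {ι κ R : Type*} [Fintype ι] [DecidableEq ι] [Fintype κ]
    [DecidableEq κ] [CommRing R] {B N : Matrix ι ι R} {U : Matrix ι κ R} {W : Matrix κ ι R}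
    {F G : Matrix κ κ R} (hWU : W * U = 1) (hB : B * U = U * F) (hN : N * U = U * G)
    (hFG : F * G = G * F) (hcompl : B * (1 - U * W) = N * (1 - U * W)) :
    B.det * G.det = N.det * F.det := by
  have hdet (H : Matrix κ κ R) : (1 - U * W + U * H * W).det = H.det := by
    have : 1 - U * W + U * H * W = 1 + U * ((H - 1) * W) := by
      simp only [Matrix.sub_mul, Matrix.mul_sub, Matrix.one_mul, Matrix.mul_assoc]
      abel
    rw [this, Matrix.det_one_add_mul_comm, Matrix.mul_assoc, hWU, Matrix.mul_one,
      add_sub_cancel]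
  rw [← hdet G, ← hdet F, ← Matrix.det_mul, ← Matrix.det_mul, Matrix.mul_add, Matrix.mul_add,
    hcompl, ← Matrix.mul_assoc, ← Matrix.mul_assoc, ← Matrix.mul_assoc, ← Matrix.mul_assoc,
    hB, hN, Matrix.mul_assoc U, Matrix.mul_assoc U G, hFG]

lemma det_one_sub_smul_deflation {ι κ R : Type*} [Fintype ι] [DecidableEq ι] [Fintype κ]
    [DecidableEq κ] [CommRing R] {U : Matrix ι κ R} {W : Matrix κ ι R} (hWU : W * U = 1)
    (d : κ → R) (b : R) :
    (1 - b • (U * Matrix.diagonal d * W)).det = ∏ i, (1 - b * d i) := by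
  have : 1 - b • (U * Matrix.diagonal d * W) = 1 + U * ((-b) • (Matrix.diagonal d * W)) := by
    rw [Matrix.mul_smul, neg_smul, ← sub_eq_add_neg, Matrix.mul_assoc]
  rw [this, Matrix.det_one_add_mul_comm, Matrix.smul_mul, Matrix.mul_assoc, hWU, Matrix.mul_one,
    ← Matrix.diagonal_one, ← Matrix.diagonal_smul, Matrix.diagonal_add, Matrix.det_diagonal]
  exact Finset.prod_congr rfl fun i _ => by simp [sub_eq_add_neg]

/-- The characteristic polynomial of the iteration matrix
`A = (1 - b E)⁻¹ (c + b (M - E))` of a deflated relaxed fixed-point iteration. -/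
lemma charpoly_deflated_iteration {K : Type*} [Field K] [Infinite K] {s m : ℕ}
    {M A : Matrix (Fin (s + m)) (Fin (s + m)) K} {l : Fin (s + m) → K}
    (hchar : M.charpoly = ∏ i, (X - C (l i)))
    {U : Matrix (Fin (s + m)) (Fin s) K} {W : Matrix (Fin s) (Fin (s + m)) K} (hWU : W * U = 1)
    (hMU : M * U = U * Matrix.diagonal fun i => l (Fin.castAdd m i))
    {E : Matrix (Fin (s + m)) (Fin (s + m)) K}
    (hE : E = U * (Matrix.diagonal fun i => l (Fin.castAdd m i)) * W) (b c : K)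
    (hA : (1 - b • E) * A = c • 1 + b • (M - E)) :
    C (1 - b • E).det * A.charpoly =
      (∏ i : Fin s, (C (1 - b * l (Fin.castAdd m i)) * X - C c)) *
        ∏ j : Fin m, (X - C (c + b * l (Fin.natAdd s j))) := by
  have hne : ∏ i : Fin s, (X - C (c + b * l (Fin.castAdd m i))) ≠ 0 :=
    Finset.prod_ne_zero_iff.2 fun i _ => X_sub_C_ne_zero _
  refine mul_right_cancel₀ hne (Polynomial.funext fun x => ?_)
  set D : Matrix (Fin s) (Fin s) K := Matrix.diagonal fun i => l (Fin.castAdd m i) with hD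
  have hEU : E * U = U * D := by rw [hE, Matrix.mul_assoc, hWU, Matrix.mul_one]
  have hEQ : E * (1 - U * W) = 0 := by
    rw [Matrix.mul_sub, ← Matrix.mul_assoc, hEU, hE, Matrix.mul_one, sub_self]
  have key := det_mul_det_eq_of_eq_on_compl (B := x • (1 - b • E) - (c • 1 + b • (M - E)))
    (N := (x - c) • 1 - b • M) (F := x • (1 - b • D) - c • 1) (G := (x - c) • 1 - b • D) hWU
    (by simp [Matrix.sub_mul, Matrix.add_mul, Matrix.mul_sub, hEU, hMU])
    (by simp [Matrix.sub_mul, Matrix.mul_sub, hMU])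
    (by
      simp only [Matrix.sub_mul, Matrix.mul_sub, Matrix.smul_mul, Matrix.mul_smul, Matrix.one_mul,
        Matrix.mul_one, smul_sub, smul_smul]
      module)
    (by
      simp only [Matrix.sub_mul, Matrix.add_mul, Matrix.smul_mul, hEQ, Matrix.one_mul]
      module)
  have hB : x • (1 - b • E) - (c • 1 + b • (M - E)) =
      (1 - b • E) * (Matrix.scalar (Fin (s + m)) x - A) := by
    rw [Matrix.mul_sub, hA, Matrix.scalar_apply, ← Matrix.smul_one_eq_diagonal, Matrix.mul_smul,
      Matrix.mul_one]
  have hF : (x • (1 - b • D) - c • 1).det =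
      ∏ i : Fin s, ((1 - b * l (Fin.castAdd m i)) * x - c) := by
    rw [hD, ← Matrix.diagonal_one, ← Matrix.diagonal_smul, Matrix.diagonal_sub,
      ← Matrix.diagonal_smul, ← Matrix.diagonal_smul, Matrix.diagonal_sub, Matrix.det_diagonal]
    exact Finset.prod_congr rfl fun i _ => by simp [mul_comm]
  have hG : ((x - c) • 1 - b • D).det = ∏ i : Fin s, (x - (c + b * l (Fin.castAdd m i))) := by
    rw [hD, ← Matrix.diagonal_one, ← Matrix.diagonal_smul, ← Matrix.diagonal_smul,
      Matrix.diagonal_sub, Matrix.det_diagonal]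
    exact Finset.prod_congr rfl fun i _ => by simp [sub_sub]
  rw [hB, Matrix.det_mul, ← Matrix.eval_charpoly, hF, hG,
    det_smul_one_sub_smul_of_charpoly_eq_prod hchar, Fin.prod_univ_add] at key
  simp only [eval_mul, eval_prod, eval_sub, eval_C, eval_X]
  rw [key]
  simp only [sub_sub]
  ring

open scoped Matrix.Norms.Operator in
/-- Powers of a matrix grow at most like powers of any number exceeding its spectral radius. -/
lemma exists_norm_pow_mulVec_le {ι : Type*} [Fintype ι] [DecidableEq ι]
    (A : Matrix ι ι ℂ) {ρ R : ℝ} (hρ : 0 ≤ ρ) (hR : ρ < R)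
    (hspec : ∀ μ ∈ spectrum ℂ A, ‖μ‖ ≤ ρ) :
    ∃ K ≥ 0, ∀ (k : ℕ) (x : ι → ℂ), ‖(A ^ k).mulVec x‖ ≤ K * R ^ k * ‖x‖ := by
  have hR0 : 0 < R := hρ.trans_lt hR
  have hrad : spectralRadius ℂ A < ENNReal.ofReal R := by
    refine lt_of_le_of_lt (iSup₂_le fun μ hμ => ?_) ((ENNReal.ofReal_lt_ofReal_iff hR0).2 hR)
    rw [← enorm_eq_nnnorm, ← ofReal_norm]
    exact ENNReal.ofReal_le_ofReal (hspec μ hμ)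
  have hO : (fun k : ℕ => A ^ k) =O[Filter.atTop] fun k : ℕ => R ^ k := by
    refine Asymptotics.IsBigO.of_bound 1 ?_
    filter_upwards [(spectrum.pow_norm_pow_one_div_tendsto_nhds_spectralRadius A).eventually_lt_const
      hrad, Filter.eventually_gt_atTop 0] with k hk hk0
    have h1 : ‖A ^ k‖ ^ (1 / (k : ℝ)) ≤ R := ((ENNReal.ofReal_lt_ofReal_iff hR0).1 hk).le
    rw [one_mul, Real.norm_of_nonneg (by positivity)]
    calc ‖A ^ k‖ = (‖A ^ k‖ ^ (1 / (k : ℝ))) ^ k := by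
          rw [one_div, Real.rpow_inv_natCast_pow (norm_nonneg _) hk0.ne']
      _ ≤ R ^ k := pow_le_pow_left₀ (by positivity) h1 k
  obtain ⟨K, hK, hbound⟩ := Asymptotics.bound_of_isBigO_nat_atTop hO
  refine ⟨K, hK.le, fun k x => (Matrix.linfty_opNorm_mulVec _ _).trans ?_⟩
  have := hbound (pow_pos hR0 k).ne'
  rw [Real.norm_of_nonneg (by positivity)] at this
  gcongr

open scoped Matrix.Norms.Operator in
lemma norm_le_one_of_isRoot_charpoly_of_rowStochastic {ι : Type*} [Fintype ι] [DecidableEq ι]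
    {P : Matrix ι ι ℝ} (hP0 : ∀ x y, 0 ≤ P x y) (hP1 : ∀ x, ∑ y, P x y = 1) {μ : ℂ}
    (hμ : (P.map (fun t => (t : ℂ))).charpoly.IsRoot μ) : ‖μ‖ ≤ 1 := by
  have hmem : μ ∈ spectrum ℂ (P.map (fun t => (t : ℂ))) :=
    Matrix.mem_spectrum_iff_isRoot_charpoly.2 hμ
  have : Nonempty ι := by
    by_contra h
    rw [not_nonempty_iff] at h
    simp [Matrix.charpoly] at hμ
  refine (spectrum.norm_le_norm_of_mem hmem).trans ?_
  rw [Matrix.linfty_opNorm_def]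
  norm_cast
  refine Finset.sup_le fun i _ => ?_
  rw [← NNReal.coe_le_coe]
  simp [abs_of_nonneg (hP0 i _), hP1 i]

/-- **Convergence rate of DDVI (policy evaluation).** For a row-stochastic `P` with
eigenvalues `λ₁,…,λₙ` ordered by decreasing magnitude, deflation matrix
`Eₛ = ∑ λᵢ uᵢ vᵢᴴ`, relaxation parameter `α ∈ (0,1]`, and the DDVI iterates
`V^{k+1} = (I-αγEₛ)⁻¹(αr + ((1-α)I + αγ(P-Eₛ))V^k)`, the error satisfies
`‖V^k - V^π‖ = Õ(λ̄^k ‖V⁰ - V^π‖)` where `λ̄` is the maximum of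
`|(1-α)/(1-αγλᵢ)|` for `i ≤ s` and `|1-α+αγλⱼ|` for `j > s`. -/
theorem ddvi_convergence_rate {n : ℕ} (P : Matrix (Fin n) (Fin n) ℝ)
    (hP0 : ∀ x y, 0 ≤ P x y) (hP1 : ∀ x, ∑ y, P x y = 1)
    (Pc : Matrix (Fin n) (Fin n) ℂ) (hPc : Pc = P.map (fun t => (t : ℂ)))
    (lam : Fin n → ℂ)
    (hchar : Pc.charpoly = ∏ i : Fin n, (X - C (lam i)))
    (hord : ∀ i j : Fin n, i ≤ j → ‖lam j‖ ≤ ‖lam i‖)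
    (γ : ℝ) (hγ0 : 0 ≤ γ) (hγ1 : γ < 1)
    (r : Fin n → ℂ) (Vpi : Fin n → ℂ)
    (hVpi : Vpi = ((1 : Matrix (Fin n) (Fin n) ℂ) - (γ : ℂ) • Pc)⁻¹.mulVec r)
    (s : ℕ) (hs : s < n)
    (u v : Fin s → Fin n → ℂ)
    (hu : ∀ i : Fin s, Pc.mulVec (u i) = lam (Fin.castLE hs.le i) • u i)
    (hbi : ∀ i j : Fin s, star (v i) ⬝ᵥ u j = if i = j then 1 else 0)
    (E : Matrix (Fin n) (Fin n) ℂ)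
    (hE : E = ∑ i : Fin s, lam (Fin.castLE hs.le i) • vecMulVec (u i) (star (v i)))
    (α : ℝ) (hα0 : 0 < α) (hα1 : α ≤ 1)
    (V : ℕ → Fin n → ℂ)
    (hV : ∀ k : ℕ, V (k + 1) =
      ((1 : Matrix (Fin n) (Fin n) ℂ) - ((α : ℂ) * (γ : ℂ)) • E)⁻¹.mulVec
        ((α : ℂ) • r + ((1 - (α : ℂ)) • V k + ((α : ℂ) * (γ : ℂ)) • (Pc - E).mulVec (V k))))
    (lamBar : ℝ)
    (hlamBar : IsGreatest
      ({x : ℝ | ∃ i : Fin n, (i : ℕ) < s ∧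
          x = ‖(1 - (α : ℂ)) / (1 - (α : ℂ) * (γ : ℂ) * lam i)‖} ∪
       {x : ℝ | ∃ j : Fin n, s ≤ (j : ℕ) ∧
          x = ‖1 - (α : ℂ) + (α : ℂ) * (γ : ℂ) * lam j‖}) lamBar) :
    ∀ ε > 0, ∃ C ≥ 0, ∀ k : ℕ,
      ‖V k - Vpi‖ ≤ C * (lamBar + ε) ^ k * ‖V 0 - Vpi‖ := by
  intro ε hε
  subst hPc
  set M := P.map (fun t => (t : ℂ)) with hM
  obtain ⟨m, rfl⟩ := Nat.exists_eq_add_of_le hs.le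
  set b : ℂ := (α : ℂ) * (γ : ℂ) with hb
  set c : ℂ := 1 - (α : ℂ) with hc
  have hlam (i) : ‖lam i‖ ≤ 1 := by
    refine norm_le_one_of_isRoot_charpoly_of_rowStochastic hP0 hP1 ?_
    rw [← hM, hchar, IsRoot, eval_prod]
    exact Finset.prod_eq_zero (Finset.mem_univ i) (by simp)
  have hne {t : ℝ} (ht0 : 0 ≤ t) (ht1 : t < 1) (i) : 1 - (t : ℂ) * lam i ≠ 0 := by
    intro h
    have h1 : ‖(t : ℂ) * lam i‖ = 1 := by rw [← sub_eq_zero.1 h, norm_one]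
    rw [norm_mul, Complex.norm_of_nonneg ht0] at h1
    nlinarith [hlam i, norm_nonneg (lam i)]
  have hneb (i) : 1 - b * lam i ≠ 0 := by
    have := hne (mul_nonneg hα0.le hγ0) (mul_lt_one_of_nonneg_of_lt_one_right hα1 hγ0 hγ1) i
    rwa [Complex.ofReal_mul] at this
  have hVpi_eq : Vpi - (γ : ℂ) • M.mulVec Vpi = r := by
    have hdet : IsUnit ((1 : Matrix _ _ ℂ) - (γ : ℂ) • M).det := by
      have := det_smul_one_sub_smul_of_charpoly_eq_prod hchar 1 (γ : ℂ)
      rw [one_smul] at this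
      rw [this, isUnit_iff_ne_zero]
      exact Finset.prod_ne_zero_iff.2 fun i _ => hne hγ0 hγ1 i
    have : ((1 : Matrix _ _ ℂ) - (γ : ℂ) • M).mulVec Vpi = r := by
      rw [hVpi, Matrix.mulVec_mulVec, Matrix.mul_nonsing_inv _ hdet, Matrix.one_mulVec]
    rwa [Matrix.sub_mulVec, Matrix.one_mulVec, Matrix.smul_mulVec] at this
  set U : Matrix (Fin (s + m)) (Fin s) ℂ := Matrix.of fun x i => u i x with hU
  set W : Matrix (Fin s) (Fin (s + m)) ℂ := Matrix.of fun i => star (v i) with hW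
  have hWU : W * U = 1 := by
    ext i j
    rw [Matrix.one_apply, ← hbi i j]
    rfl
  have hMU : M * U = U * Matrix.diagonal fun i => lam (Fin.castAdd m i) := by
    ext x i
    rw [Matrix.mul_diagonal]
    exact (congrFun (hu i) x).trans (mul_comm _ _)
  have hEU : E = U * (Matrix.diagonal fun i => lam (Fin.castAdd m i)) * W := by
    ext x y
    rw [hE, Matrix.sum_apply, Matrix.mul_apply]
    refine Finset.sum_congr rfl fun i _ => ?_
    rw [Matrix.mul_diagonal]
    simp only [hU, hW, Matrix.smul_apply, Matrix.vecMulVec_apply, Matrix.of_apply, smul_eq_mul,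
      Fin.castAdd]
    ring
  have hdetE : (1 - b • E).det ≠ 0 := by
    rw [hEU, det_one_sub_smul_deflation hWU]
    exact Finset.prod_ne_zero_iff.2 fun i _ => hneb _
  have hunit : IsUnit (1 - b • E).det := isUnit_iff_ne_zero.2 hdetE
  set A := (1 - b • E)⁻¹ * (c • 1 + b • (M - E)) with hA
  have hcharA := charpoly_deflated_iteration hchar hWU hMU hEU b c
    (Matrix.mul_nonsing_inv_cancel_left _ _ hunit)
  have hspec : ∀ μ ∈ spectrum ℂ A, ‖μ‖ ≤ lamBar := by
    intro μ hμ
    have hroot : A.charpoly.eval μ = 0 := Matrix.mem_spectrum_iff_isRoot_charpoly.1 hμ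
    have h0 := congrArg (eval μ) hcharA
    rw [eval_mul, hroot, mul_zero, eval_mul, eval_prod, eval_prod, eq_comm, mul_eq_zero,
      Finset.prod_eq_zero_iff, Finset.prod_eq_zero_iff] at h0
    simp only [eval_sub, eval_mul, eval_C, eval_X, Finset.mem_univ, true_and, sub_eq_zero] at h0
    refine hlamBar.2 ?_
    rcases h0 with ⟨i, hi⟩ | ⟨j, hj⟩
    · refine Or.inl ⟨Fin.castAdd m i, i.2, ?_⟩
      rw [eq_div_of_mul_eq (hneb _) ((mul_comm _ _).trans hi)]
    · exact Or.inr ⟨Fin.natAdd s j, Nat.le_add_right _ _, by rw [hj]⟩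
  have hlam0 : 0 ≤ lamBar := by
    rcases hlamBar.1 with ⟨_, _, h⟩ | ⟨_, _, h⟩ <;> exact h ▸ norm_nonneg _
  have hfix : Vpi = (1 - b • E)⁻¹.mulVec
      ((α : ℂ) • r + (c • Vpi + b • (M - E).mulVec Vpi)) := by
    have : (α : ℂ) • r + (c • Vpi + b • (M - E).mulVec Vpi) = (1 - b • E).mulVec Vpi := by
      rw [← hVpi_eq, Matrix.sub_mulVec, Matrix.sub_mulVec, Matrix.one_mulVec, Matrix.smul_mulVec,
        hb, hc]
      module
    rw [this, Matrix.mulVec_mulVec, Matrix.nonsing_inv_mul _ hunit, Matrix.one_mulVec]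
  have hstep (k : ℕ) : V (k + 1) - Vpi = A.mulVec (V k - Vpi) := by
    rw [hV k]
    nth_rewrite 1 [hfix]
    rw [← Matrix.mulVec_sub, hA, ← Matrix.mulVec_mulVec, Matrix.add_mulVec, Matrix.smul_mulVec,
      Matrix.one_mulVec, Matrix.smul_mulVec, Matrix.mulVec_sub (M - E)]
    congr 1
    module
  have herr (k : ℕ) : V k - Vpi = (A ^ k).mulVec (V 0 - Vpi) := by
    induction k with
    | zero => simp
    | succ k ih => rw [hstep, ih, Matrix.mulVec_mulVec, pow_succ']
  obtain ⟨K, hK, hbound⟩ := exists_norm_pow_mulVec_le A hlam0 (lt_add_of_pos_right _ hε) hspec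
  exact ⟨K, hK, fun k => herr k ▸ hbound k _⟩
end

section
/- Let P be an n×n row-stochastic real matrix, regarded as a complex matrix, whose characteristic polynomial factors as ∏_{i=1}^n (X − λ_i) with |λ_1| ≥ … ≥ |λ_n|, let γ ∈ [0,1), r ∈ ℂ^n, and V^π = (I − γP)^{−1} r. Let s < n, let u_1,…,u_s ∈ ℂ^n satisfy P u_i = λ_i u_i, let v_1,…,v_s ∈ ℂ^n satisfy v_iᴴ u_i = 1 and v_iᴴ u_j = 0 for i ≠ j, and set E_s = ∑_{i=1}^s λ_i u_i v_iᴴ. Define the rank-s DDVI iterates with α = 1 by W^{k+1} = γ(P − E_s)V^k + r and V^{k+1} = (I + ∑_{i=1}^s (γλ_i/(1 − γλ_i)) u_i v_iᴴ) W^{k+1}, starting from any V^0 ∈ ℂ^n. Then for every ε > 0 there exists C ≥ 0 such that ‖V^k − V^π‖_∞ ≤ C (γ|λ_{s+1}| + ε)^k ‖V^0 − V^π‖_∞ for all k ≥ 0. -/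
open Matrix Polynomial

theorem Fin.prod_univ_eq_prod_castLE_mul {M : Type*} [CommMonoid M] {s n : ℕ} (h : s ≤ n)
    (f : Fin n → M) :
    ∏ i, f i = (∏ i : Fin s, f (Fin.castLE h i)) *
      ∏ i ∈ Finset.univ.filter (fun i : Fin n => s ≤ (i : ℕ)), f i := by
  rw [← Finset.prod_filter_mul_prod_filter_not Finset.univ (fun i : Fin n => (i : ℕ) < s)]
  simp only [not_lt]
  congr 1
  symm
  refine Finset.prod_bij (fun i _ => Fin.castLE h i) ?_ ?_ ?_ ?_
  · intro i _
    simp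
  · intro i _ j _ hij
    simpa using hij
  · intro j hj
    exact ⟨⟨j, by simpa using hj⟩, Finset.mem_univ _, rfl⟩
  · intro i _
    rfl

namespace Matrix

theorem sum_smul_vecMulVec {R m k : Type*} [CommRing R] [DecidableEq k] [Fintype k]
    (u v : k → m → R) (c : k → R) :
    ∑ i, c i • vecMulVec (u i) (v i) = (of u)ᵀ * diagonal c * of v := by
  ext x y
  rw [mul_apply]
  simp only [sum_apply, smul_apply, vecMulVec_apply, mul_diagonal, transpose_apply,
    of_apply, smul_eq_mul]
  exact Finset.sum_congr rfl fun i _ => by ring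

section Deflation

variable {R m k : Type*} [CommRing R] [Fintype m] [DecidableEq m] [Fintype k] [DecidableEq k]
  {U : Matrix m k R} {Y : Matrix k m R}

theorem det_one_add_mul_sub_one_mul (hYU : Y * U = 1) (d : Matrix k k R) :
    (1 + U * (d - 1) * Y).det = d.det := by
  rw [Matrix.mul_assoc, det_one_add_mul_comm, Matrix.mul_assoc, hYU]
  simp

theorem det_mul_one_sub_add (hYU : Y * U = 1) (B : Matrix m m R) (d : Matrix k k R) :
    (B * (1 - U * Y) + U * d * Y).det = (B * (1 - U * Y) + U * Y).det * d.det := by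
  rw [← det_one_add_mul_sub_one_mul hYU d, ← det_mul]
  congr 1
  have h1 : (1 - U * Y) * (1 + U * (d - 1) * Y) = 1 - U * Y := by
    have : (1 - U * Y) * U = 0 := by
      rw [Matrix.sub_mul, Matrix.mul_assoc, hYU]; simp
    rw [Matrix.mul_add, ← Matrix.mul_assoc, ← Matrix.mul_assoc, this]; simp
  have h2 : Y * (1 + U * (d - 1) * Y) = d * Y := by
    rw [Matrix.mul_add, ← Matrix.mul_assoc, ← Matrix.mul_assoc, hYU]
    simp [Matrix.sub_mul]
  rw [Matrix.add_mul, Matrix.mul_assoc B, h1, Matrix.mul_assoc U Y, h2, Matrix.mul_assoc]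

end Deflation

section Complex

variable {m k : Type*} [Fintype m] [DecidableEq m] [Fintype k] [DecidableEq k]
  {A : Matrix m m ℂ} {U : Matrix m k ℂ} {Y : Matrix k m ℂ} {g : k → ℂ} {q : ℂ → ℂ}

/-- Cancelling the known eigenvalues from a factorization of `det (z - A)`. -/
theorem det_scalar_sub_deflated (hAU : A * U = U * diagonal g) (hYU : Y * U = 1)
    (hq : Continuous q) (hA : ∀ z : ℂ, (z • 1 - A).det = (∏ i, (z - g i)) * q z) (z : ℂ) :
    ((z • 1 - A) * (1 - U * Y) + U * Y).det = q z := by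
  have hdense : Dense (Set.range g)ᶜ := (Set.finite_range g).countable.dense_compl ℝ
  refine congrFun (Continuous.ext_on (f := fun z : ℂ =>
    ((z • 1 - A) * (1 - U * Y) + U * Y).det) hdense
    (Continuous.matrix_det (by fun_prop)) hq fun w hw => ?_) z
  have hne : ∏ i, (w - g i) ≠ 0 := Finset.prod_ne_zero_iff.2 fun i _ h =>
    hw ⟨i, (sub_eq_zero.1 h).symm⟩
  refine mul_right_cancel₀ hne ?_
  have hd : (diagonal fun i => w - g i).det = ∏ i, (w - g i) := det_diagonal
  rw [mul_comm (q w), ← hA w, ← hd]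
  dsimp only
  rw [← det_mul_one_sub_add hYU]
  congr 1
  have : diagonal (fun i => w - g i) = w • (1 : Matrix k k ℂ) - diagonal g := by
    ext i j
    by_cases h : i = j <;> simp [h]
  rw [this]
  simp only [Matrix.mul_sub, Matrix.sub_mul, Matrix.mul_one, Matrix.one_mul, ← hAU,
    Matrix.mul_smul, Matrix.smul_mul, ← Matrix.mul_assoc]
  abel

theorem one_sub_mul_one_add_deflation (hYU : Y * U = 1) (hg : ∀ i, 1 - g i ≠ 0) :
    (1 - U * diagonal g * Y) * (1 + U * diagonal (fun i => g i / (1 - g i)) * Y) = 1 := by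
  have h : U * diagonal g * Y * (U * diagonal (fun i => g i / (1 - g i)) * Y) =
      U * diagonal (fun i => g i * (g i / (1 - g i))) * Y := by
    rw [← diagonal_mul_diagonal]
    calc _ = U * diagonal g * (Y * U) * diagonal (fun i => g i / (1 - g i)) * Y := by
          simp only [Matrix.mul_assoc]
      _ = _ := by rw [hYU]; simp only [Matrix.mul_assoc, Matrix.one_mul]
  have h2 : diagonal (fun i => g i / (1 - g i)) =
      diagonal g + diagonal (fun i => g i * (g i / (1 - g i))) := by
    rw [diagonal_add]
    congr 1
    ext i
    have := hg i
    field_simp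
    ring
  rw [Matrix.sub_mul, Matrix.one_mul, Matrix.mul_add, Matrix.mul_one, h]
  nth_rewrite 1 [h2]
  rw [Matrix.mul_add, Matrix.add_mul]
  abel

/-- The characteristic determinant of the deflated iteration matrix. -/
theorem det_scalar_sub_deflation_iteration (hAU : A * U = U * diagonal g) (hYU : Y * U = 1)
    (hg : ∀ i, 1 - g i ≠ 0) (hq : Continuous q)
    (hA : ∀ z : ℂ, (z • 1 - A).det = (∏ i, (z - g i)) * q z) (z : ℂ) :
    (z • 1 - (1 + U * diagonal (fun i => g i / (1 - g i)) * Y) *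
      (A - U * diagonal g * Y)).det = z ^ Fintype.card k * q z := by
  set D := 1 + U * diagonal (fun i => g i / (1 - g i)) * Y
  have hD : (1 - U * diagonal g * Y) * D = 1 := one_sub_mul_one_add_deflation hYU hg
  have hdet : (1 - U * diagonal g * Y).det = ∏ i, (1 - g i) := by
    rw [← det_diagonal, ← det_one_add_mul_sub_one_mul hYU]
    congr 1
    have : diagonal (fun i => 1 - g i) - 1 = -diagonal g := by
      ext i j
      by_cases h : i = j <;> simp [h]
    rw [this, Matrix.mul_neg, Matrix.neg_mul, sub_eq_add_neg]
  have hne : (1 - U * diagonal g * Y).det ≠ 0 := by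
    rw [hdet]
    exact Finset.prod_ne_zero_iff.2 fun i _ => hg i
  refine mul_left_cancel₀ hne ?_
  rw [← det_mul, Matrix.mul_sub, ← Matrix.mul_assoc, hD, Matrix.one_mul, hdet,
    ← det_scalar_sub_deflated hAU hYU hq hA z]
  have hd : (diagonal fun i => z * (1 - g i)).det =
      (∏ i, (1 - g i)) * z ^ Fintype.card k := by
    rw [det_diagonal, Finset.prod_mul_distrib, mul_comm]
    simp
  rw [← mul_assoc, ← hd, mul_comm, ← det_mul_one_sub_add hYU]
  congr 1
  have : diagonal (fun i => z * (1 - g i)) = z • (1 : Matrix k k ℂ) - z • diagonal g := by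
    ext i j
    by_cases h : i = j <;> simp [h, mul_sub]
  rw [this]
  simp only [Matrix.mul_sub, Matrix.sub_mul, Matrix.mul_one, Matrix.one_mul, ← hAU,
    Matrix.mul_smul, Matrix.smul_mul, ← Matrix.mul_assoc, smul_sub]
  abel

theorem det_smul_one_sub_smul {n : ℕ} {B : Matrix (Fin n) (Fin n) ℂ} {lam : Fin n → ℂ}
    (hB : B.charpoly = ∏ i, (X - C (lam i))) (c z : ℂ) :
    (z • 1 - c • B).det = ∏ i, (z - c * lam i) := by
  by_cases hc : c = 0
  · simp [hc]
  have h : z • 1 - c • B = c • (scalar (Fin n) (z / c) - B) := by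
    rw [smul_sub, scalar_apply, ← smul_one_eq_diagonal, smul_smul, mul_div_cancel₀ _ hc]
  rw [h, det_smul, ← eval_charpoly, hB, eval_prod, Fintype.card_fin]
  have : c ^ n = ∏ _i : Fin n, c := by simp
  rw [this, ← Finset.prod_mul_distrib]
  refine Finset.prod_congr rfl fun i _ => ?_
  simp only [eval_sub, eval_X, eval_C]
  field_simp

end Complex

end Matrix

open Filter in
/-- Powers are dominated by any rate exceeding the moduli of the spectrum. -/
theorem spectrum.exists_norm_pow_le {A : Type*} [NormedRing A] [NormedAlgebra ℂ A]
    [CompleteSpace A] [Nontrivial A] (a : A) {ρ : ℝ} (hρ : 0 < ρ)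
    (h : ∀ z ∈ spectrum ℂ a, ‖z‖ < ρ) :
    ∃ K ≥ 0, ∀ k : ℕ, ‖a ^ k‖ ≤ K * ρ ^ k := by
  lift ρ to NNReal using hρ.le
  have hr : spectralRadius ℂ a < ρ :=
    spectralRadius_lt_of_forall_lt a fun z hz => NNReal.coe_lt_coe.1 (h z hz)
  have hev : ∀ᶠ k : ℕ in atTop, ‖a ^ k‖ ≤ ρ ^ k := by
    filter_upwards [(pow_nnnorm_pow_one_div_tendsto_nhds_spectralRadius a).eventually_lt_const hr,
      eventually_ge_atTop 1] with k hk hk1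
    rw [one_div, ENNReal.rpow_inv_lt_iff (by exact_mod_cast hk1)] at hk
    rw [ENNReal.rpow_natCast] at hk
    exact_mod_cast hk.le
  obtain ⟨N, hN⟩ := eventually_atTop.1 hev
  refine ⟨1 + ∑ j ∈ Finset.range N, ‖a ^ j‖ / ρ ^ j, by positivity, fun k => ?_⟩
  have hpos : 0 < (ρ : ℝ) ^ k := pow_pos hρ k
  rw [← div_le_iff₀ hpos]
  rcases le_or_gt N k with hk | hk
  · calc ‖a ^ k‖ / ρ ^ k ≤ 1 := (div_le_one hpos).2 (hN k hk)
      _ ≤ _ := le_add_of_nonneg_right (by positivity)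
  · calc ‖a ^ k‖ / ρ ^ k ≤ ∑ j ∈ Finset.range N, ‖a ^ j‖ / ρ ^ j :=
        Finset.single_le_sum (f := fun j => ‖a ^ j‖ / ρ ^ j) (fun j _ => by positivity)
          (Finset.mem_range.2 hk)
      _ ≤ _ := le_add_of_nonneg_left zero_le_one

attribute [local instance] Matrix.linftyOpNormedRing Matrix.linftyOpNormedAlgebra

theorem Matrix.exists_norm_pow_mulVec_le {n : ℕ} (M : Matrix (Fin n) (Fin n) ℂ) {ρ : ℝ}
    (hρ : 0 < ρ) (h : ∀ z : ℂ, (z • 1 - M).det = 0 → ‖z‖ < ρ) :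
    ∃ K ≥ 0, ∀ (k : ℕ) (x : Fin n → ℂ), ‖(M ^ k) *ᵥ x‖ ≤ K * ρ ^ k * ‖x‖ := by
  rcases subsingleton_or_nontrivial (Matrix (Fin n) (Fin n) ℂ) with hs | hs
  · refine ⟨0, le_rfl, fun k x => ?_⟩
    simp [Subsingleton.elim (M ^ k) 0]
  have : CompleteSpace (Matrix (Fin n) (Fin n) ℂ) := FiniteDimensional.complete ℂ _
  obtain ⟨K, hK, hle⟩ := spectrum.exists_norm_pow_le M hρ fun z hz => h z <| by
    rw [spectrum.mem_iff, isUnit_iff_isUnit_det, isUnit_iff_ne_zero, not_not] at hz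
    rwa [Algebra.algebraMap_eq_smul_one] at hz
  refine ⟨K, hK, fun k x => (linfty_opNorm_mulVec _ _).trans ?_⟩
  exact mul_le_mul_of_nonneg_right (hle k) (norm_nonneg x)

theorem Matrix.linfty_opNorm_map_ofReal_le_one {n : ℕ} {P : Matrix (Fin n) (Fin n) ℝ}
    (hP0 : ∀ x y, 0 ≤ P x y) (hP1 : ∀ x, ∑ y, P x y = 1) :
    ‖P.map (fun t => (t : ℂ))‖ ≤ 1 := by
  rw [← coe_nnnorm, ← NNReal.coe_one, NNReal.coe_le_coe, linfty_opNNNorm_def]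
  refine Finset.sup_le fun x _ => ?_
  rw [← NNReal.coe_le_coe]
  simp [abs_of_nonneg (hP0 x _), hP1]

/-- **Convergence rate of rank-`s` DDVI with `α = 1`.** With the deflation matrix
`Eₛ = ∑ λᵢ uᵢ vᵢᴴ` and iterates `W^{k+1} = γ(P-Eₛ)V^k + r`,
`V^{k+1} = (I + ∑ (γλᵢ/(1-γλᵢ)) uᵢ vᵢᴴ) W^{k+1}`, the error satisfies
`‖V^k - V^π‖ = Õ((γ|λ_{s+1}|)^k ‖V⁰ - V^π‖)`. -/
theorem ddvi_alpha_one_convergence_rate {n : ℕ} (P : Matrix (Fin n) (Fin n) ℝ)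
    (hP0 : ∀ x y, 0 ≤ P x y) (hP1 : ∀ x, ∑ y, P x y = 1)
    (Pc : Matrix (Fin n) (Fin n) ℂ) (hPc : Pc = P.map (fun t => (t : ℂ)))
    (lam : Fin n → ℂ)
    (hchar : Pc.charpoly = ∏ i : Fin n, (X - C (lam i)))
    (hord : ∀ i j : Fin n, i ≤ j → ‖lam j‖ ≤ ‖lam i‖)
    (γ : ℝ) (hγ0 : 0 ≤ γ) (hγ1 : γ < 1)
    (r : Fin n → ℂ) (Vpi : Fin n → ℂ)
    (hVpi : Vpi = ((1 : Matrix (Fin n) (Fin n) ℂ) - (γ : ℂ) • Pc)⁻¹.mulVec r)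
    (s : ℕ) (hs : s < n)
    (u v : Fin s → Fin n → ℂ)
    (hu : ∀ i : Fin s, Pc.mulVec (u i) = lam (Fin.castLE hs.le i) • u i)
    (hbi : ∀ i j : Fin s, star (v i) ⬝ᵥ u j = if i = j then 1 else 0)
    (E : Matrix (Fin n) (Fin n) ℂ)
    (hE : E = ∑ i : Fin s, lam (Fin.castLE hs.le i) • vecMulVec (u i) (star (v i)))
    (W V : ℕ → Fin n → ℂ)
    (hW : ∀ k : ℕ, W (k + 1) = (γ : ℂ) • (Pc - E).mulVec (V k) + r)
    (hV : ∀ k : ℕ, V (k + 1) =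
      ((1 : Matrix (Fin n) (Fin n) ℂ) +
        ∑ i : Fin s, ((γ : ℂ) * lam (Fin.castLE hs.le i) /
          (1 - (γ : ℂ) * lam (Fin.castLE hs.le i))) • vecMulVec (u i) (star (v i))).mulVec
        (W (k + 1))) :
    ∀ ε > 0, ∃ C ≥ 0, ∀ k : ℕ,
      ‖V k - Vpi‖ ≤ C * (γ * ‖lam ⟨s, hs⟩‖ + ε) ^ k * ‖V 0 - Vpi‖ := by
  intro ε hε
  have hnorm : ‖Pc‖ ≤ 1 := hPc ▸ linfty_opNorm_map_ofReal_le_one hP0 hP1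
  have hγP : ‖(γ : ℂ) • Pc‖ < 1 := by
    rw [norm_smul, Complex.norm_real, Real.norm_of_nonneg hγ0]
    nlinarith [norm_nonneg Pc]
  have : CompleteSpace (Matrix (Fin n) (Fin n) ℂ) := FiniteDimensional.complete ℂ _
  have hfix : Vpi - (γ : ℂ) • Pc *ᵥ Vpi = r := by
    have hu : IsUnit (1 - (γ : ℂ) • Pc).det :=
      (isUnit_iff_isUnit_det _).1 (isUnit_one_sub_of_norm_lt_one hγP)
    have : (1 - (γ : ℂ) • Pc) *ᵥ Vpi = r := by
      rw [hVpi, mulVec_mulVec, mul_nonsing_inv _ hu, one_mulVec]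
    rwa [sub_mulVec, one_mulVec, smul_mulVec] at this
  set U : Matrix (Fin n) (Fin s) ℂ := (of u)ᵀ with hU
  set Y : Matrix (Fin s) (Fin n) ℂ := of fun i => star (v i) with hY
  set g : Fin s → ℂ := fun i => (γ : ℂ) * lam (Fin.castLE hs.le i) with hg
  have hYU : Y * U = 1 := by
    ext i j
    rw [one_apply, ← hbi i j]
    rfl
  have hAU : ((γ : ℂ) • Pc) * U = U * diagonal g := by
    ext x i
    have h := congrFun (hu i) x
    simp only [Pi.smul_apply, smul_eq_mul] at h
    rw [Matrix.smul_mul, Matrix.smul_apply, mul_diagonal]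
    change (γ : ℂ) * (Pc *ᵥ u i) x = u i x * _
    rw [h]
    simp only [hg]
    ring
  have hg1 : ∀ i, 1 - g i ≠ 0 := by
    intro i h0
    have hne : u i ≠ 0 := by
      intro h
      have := hbi i i
      simp [h] at this
    have h1 : ((γ : ℂ) • Pc) *ᵥ u i = u i := by
      rw [smul_mulVec, hu i, smul_smul]
      change g i • u i = u i
      rw [← sub_eq_zero.1 h0, one_smul]
    have h2 := linfty_opNorm_mulVec ((γ : ℂ) • Pc) (u i)
    rw [h1] at h2
    nlinarith [norm_pos_iff.2 hne]
  have hEg : (γ : ℂ) • E = U * diagonal g * Y := by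
    rw [hE, Finset.smul_sum, hU, hY, ← sum_smul_vecMulVec]
    simp only [smul_smul, hg]
  set D : Matrix (Fin n) (Fin n) ℂ := 1 + U * diagonal (fun i => g i / (1 - g i)) * Y with hD
  have hV' : ∀ k, V (k + 1) = D *ᵥ W (k + 1) := by
    intro k
    rw [hV k, hD, hU, hY, ← sum_smul_vecMulVec]
  have hDinv : D * (1 - U * diagonal g * Y) = 1 :=
    mul_eq_one_comm.1 (one_sub_mul_one_add_deflation hYU hg1)
  set M := D * ((γ : ℂ) • Pc - U * diagonal g * Y) with hM
  have hVpi' : Vpi = M *ᵥ Vpi + D *ᵥ r := by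
    rw [hM, ← mulVec_mulVec, ← mulVec_add]
    have : ((γ : ℂ) • Pc - U * diagonal g * Y) *ᵥ Vpi + r =
        (1 - U * diagonal g * Y) *ᵥ Vpi := by
      rw [← hfix, sub_mulVec, sub_mulVec, one_mulVec, smul_mulVec]
      abel
    rw [this, mulVec_mulVec, hDinv, one_mulVec]
  have hstep : ∀ k, V (k + 1) - Vpi = M *ᵥ (V k - Vpi) := by
    intro k
    have h1 : V (k + 1) = M *ᵥ V k + D *ᵥ r := by
      rw [hV', hW, mulVec_add, hM, ← hEg, ← smul_sub, ← mulVec_mulVec, smul_mulVec]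
    rw [mulVec_sub, h1]
    nth_rewrite 1 [hVpi']
    abel
  have hpow : ∀ k, V k - Vpi = (M ^ k) *ᵥ (V 0 - Vpi) := by
    intro k
    induction k with
    | zero => simp
    | succ k ih => rw [hstep, ih, mulVec_mulVec, pow_succ']
  have hchar' : ∀ z : ℂ, (z • 1 - (γ : ℂ) • Pc).det = (∏ i, (z - g i)) *
      ∏ i ∈ Finset.univ.filter (fun i : Fin n => s ≤ (i : ℕ)), (z - (γ : ℂ) * lam i) :=
    fun z => by rw [det_smul_one_sub_smul hchar, Fin.prod_univ_eq_prod_castLE_mul hs.le]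
  have hρ : 0 < γ * ‖lam ⟨s, hs⟩‖ + ε := by positivity
  obtain ⟨K, hK, hle⟩ := exists_norm_pow_mulVec_le M hρ fun z hz => by
    rw [hM, det_scalar_sub_deflation_iteration hAU hYU hg1 (by fun_prop) hchar', mul_eq_zero,
      Finset.prod_eq_zero_iff] at hz
    rcases hz with hz | ⟨i, hi, hz⟩
    · rw [eq_zero_of_pow_eq_zero hz, norm_zero]
      exact hρ
    · rw [sub_eq_zero.1 hz, norm_mul, Complex.norm_real, Real.norm_of_nonneg hγ0]
      have := mul_le_mul_of_nonneg_left (hord ⟨s, hs⟩ i (by simpa [Fin.le_def] using hi)) hγ0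
      linarith
  exact ⟨K, hK, fun k => hpow k ▸ hle k _⟩
end

section
/- Consider a finite MDP with state space of size n, a finite nonempty action set A, transition probabilities P(y | x, a) ≥ 0 with ∑_y P(y|x,a) = 1 for every state x and action a, rewards r(x,a) ∈ ℝ, and discount factor γ ∈ [0,1). Let V* ∈ ℝ^n satisfy the Bellman optimality equation V*(x) = max_{a ∈ A} { r(x,a) + γ ∑_y P(y|x,a) V*(y) } for all x. Let v ∈ ℝ^n have nonnegative entries summing to 1. Define the rank-1 DDVI for Control iterates by W^{k+1}(x) = max_{a ∈ A} { r(x,a) + γ ∑_y P(y|x,a) W^k(y) } − γ ∑_y v(y) W^k(y) for all x, starting from any W^0 ∈ ℝ^n, and set V^k(x) = W^k(x) + (γ/(1−γ)) ∑_y v(y) W^k(y) for all x. Then for all k ≥ 0, ‖V^k − V*‖_∞ ≤ (2/(1−γ)) γ^k ‖V^0 − V*‖_∞. -/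
/-- The Bellman optimality operator of a finite discounted MDP. -/
noncomputable def bellmanOp {S A : Type*} [Fintype S] [Fintype A] [Nonempty A]
    (P : S → A → S → ℝ) (r : S → A → ℝ) (γ : ℝ) (U : S → ℝ) : S → ℝ :=
  fun x => Finset.univ.sup' Finset.univ_nonempty (fun a => r x a + γ * ∑ y, P x a y * U y)

section bellmanOp

variable {S A : Type*} [Fintype S] [Fintype A] [Nonempty A]
  {P : S → A → S → ℝ} {r : S → A → ℝ} {γ : ℝ}

lemma le_bellmanOp (U : S → ℝ) (x : S) (a : A) :
    r x a + γ * ∑ y, P x a y * U y ≤ bellmanOp P r γ U x :=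
  Finset.le_sup' (fun a => r x a + γ * ∑ y, P x a y * U y) (Finset.mem_univ a)

lemma bellmanOp_le_add (hP0 : ∀ x a y, 0 ≤ P x a y) (hP1 : ∀ x a, ∑ y, P x a y = 1)
    (hγ0 : 0 ≤ γ) {U U' : S → ℝ} {c : ℝ} (h : ∀ y, U y ≤ U' y + c) (x : S) :
    bellmanOp P r γ U x ≤ bellmanOp P r γ U' x + γ * c := by
  refine Finset.sup'_le _ _ fun a _ => ?_
  have hsum : ∑ y, P x a y * U y ≤ ∑ y, P x a y * U' y + c := by
    calc ∑ y, P x a y * U y ≤ ∑ y, P x a y * (U' y + c) :=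
          Finset.sum_le_sum fun y _ => mul_le_mul_of_nonneg_left (h y) (hP0 x a y)
      _ = ∑ y, P x a y * U' y + c := by
          simp only [mul_add, Finset.sum_add_distrib, ← Finset.sum_mul, hP1, one_mul]
  have hU' := le_bellmanOp (P := P) (r := r) (γ := γ) U' x a
  nlinarith [mul_le_mul_of_nonneg_left hsum hγ0]

lemma bellmanOp_add_const (hP0 : ∀ x a y, 0 ≤ P x a y) (hP1 : ∀ x a, ∑ y, P x a y = 1)
    (hγ0 : 0 ≤ γ) (U : S → ℝ) (c : ℝ) (x : S) :
    bellmanOp P r γ (fun y => U y + c) x = bellmanOp P r γ U x + γ * c := by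
  refine le_antisymm (bellmanOp_le_add hP0 hP1 hγ0 (fun _ => le_rfl) x) ?_
  have := bellmanOp_le_add (r := r) hP0 hP1 hγ0 (U := U) (U' := fun y => U y + c) (c := -c)
    (fun y => by simp) x
  linarith

lemma norm_bellmanOp_sub_le (hP0 : ∀ x a y, 0 ≤ P x a y) (hP1 : ∀ x a, ∑ y, P x a y = 1)
    (hγ0 : 0 ≤ γ) (U U' : S → ℝ) :
    ‖bellmanOp P r γ U - bellmanOp P r γ U'‖ ≤ γ * ‖U - U'‖ := by
  refine (pi_norm_le_iff_of_nonneg (by positivity)).2 fun x => ?_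
  have hsub (y : S) : |U y - U' y| ≤ ‖U - U'‖ := by simpa using norm_le_pi_norm (U - U') y
  have h₁ := bellmanOp_le_add (r := r) hP0 hP1 hγ0 (U := U) (U' := U') (c := ‖U - U'‖)
    (fun y => by linarith [(abs_le.1 (hsub y)).2]) x
  have h₂ := bellmanOp_le_add (r := r) hP0 hP1 hγ0 (U := U') (U' := U) (c := ‖U - U'‖)
    (fun y => by linarith [(abs_le.1 (hsub y)).1]) x
  rw [Pi.sub_apply, Real.norm_eq_abs, abs_le]
  constructor <;> linarith

lemma norm_bellmanOp_iterate_sub_le (hP0 : ∀ x a y, 0 ≤ P x a y)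
    (hP1 : ∀ x a, ∑ y, P x a y = 1) (hγ0 : 0 ≤ γ) {Vstar : S → ℝ}
    (hfix : bellmanOp P r γ Vstar = Vstar) (U : S → ℝ) (k : ℕ) :
    ‖(bellmanOp P r γ)^[k] U - Vstar‖ ≤ γ ^ k * ‖U - Vstar‖ := by
  induction k with
  | zero => simp
  | succ k ih =>
    rw [Function.iterate_succ_apply']
    have h := norm_bellmanOp_sub_le (r := r) hP0 hP1 hγ0 ((bellmanOp P r γ)^[k] U) Vstar
    rw [hfix] at h
    calc _ ≤ _ := h
      _ ≤ γ * (γ ^ k * ‖U - Vstar‖) := mul_le_mul_of_nonneg_left ih hγ0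
      _ = γ ^ (k + 1) * ‖U - Vstar‖ := by ring

end bellmanOp

lemma abs_sum_mul_le_norm {S : Type*} [Fintype S] {v : S → ℝ} (hv0 : ∀ y, 0 ≤ v y)
    (hv1 : ∑ y, v y = 1) (U : S → ℝ) : |∑ y, v y * U y| ≤ ‖U‖ :=
  calc |∑ y, v y * U y| ≤ ∑ y, |v y * U y| := Finset.abs_sum_le_sum_abs _ _
    _ ≤ ∑ y, v y * ‖U‖ := Finset.sum_le_sum fun y _ => by
        rw [abs_mul, abs_of_nonneg (hv0 y)]
        exact mul_le_mul_of_nonneg_left (norm_le_pi_norm U y) (hv0 y)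
    _ = ‖U‖ := by rw [← Finset.sum_mul, hv1, one_mul]

lemma sum_mul_add_const {S : Type*} [Fintype S] {v : S → ℝ} (hv1 : ∑ y, v y = 1)
    (U : S → ℝ) (c : ℝ) : ∑ y, v y * (U y + c) = ∑ y, v y * U y + c := by
  simp only [mul_add, Finset.sum_add_distrib, ← Finset.sum_mul, hv1, one_mul]

/-- **Rank-1 DDVI for Control: `O(γ^k/(1-γ))` convergence.** For a finite discounted MDP
with optimal value function `V*`, nonnegative weights `v` summing to 1, and iterates
`W^{k+1}(x) = max_a {r(x,a) + γ ∑_y P(y|x,a) W^k(y)} - γ ∑_y v(y) W^k(y)`,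
`V^k = W^k + (γ/(1-γ)) (∑_y v(y) W^k(y)) 1`, one has
`‖V^k - V*‖∞ ≤ (2/(1-γ)) γ^k ‖V⁰ - V*‖∞`. -/
theorem rank1_ddvi_control_gamma_rate {n : ℕ} {A : Type*} [Fintype A] [Nonempty A]
    (P : Fin n → A → Fin n → ℝ)
    (hP0 : ∀ x a y, 0 ≤ P x a y) (hP1 : ∀ x a, ∑ y, P x a y = 1)
    (r : Fin n → A → ℝ)
    (γ : ℝ) (hγ0 : 0 ≤ γ) (hγ1 : γ < 1)
    (Vstar : Fin n → ℝ)
    (hVstar : ∀ x, Vstar x = Finset.univ.sup' Finset.univ_nonempty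
        (fun a => r x a + γ * ∑ y, P x a y * Vstar y))
    (v : Fin n → ℝ) (hv0 : ∀ y, 0 ≤ v y) (hv1 : ∑ y, v y = 1)
    (W : ℕ → Fin n → ℝ)
    (hW : ∀ k x, W (k + 1) x = Finset.univ.sup' Finset.univ_nonempty
        (fun a => r x a + γ * ∑ y, P x a y * W k y) - γ * ∑ y, v y * W k y)
    (V : ℕ → Fin n → ℝ)
    (hV : ∀ k x, V k x = W k x + γ / (1 - γ) * ∑ y, v y * W k y) :
    ∀ k : ℕ, ‖V k - Vstar‖ ≤ 2 / (1 - γ) * γ ^ k * ‖V 0 - Vstar‖ := by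
  have hγ : 0 < 1 - γ := sub_pos.2 hγ1
  have hfix : bellmanOp P r γ Vstar = Vstar := funext fun x => (hVstar x).symm
  set U : ℕ → Fin n → ℝ := fun k => (bellmanOp P r γ)^[k] (V 0) with hU
  have hUsucc (k : ℕ) : U (k + 1) = bellmanOp P r γ (U k) := Function.iterate_succ_apply' _ _ _
  have hUnorm (k : ℕ) : ‖U k - Vstar‖ ≤ γ ^ k * ‖V 0 - Vstar‖ :=
    norm_bellmanOp_iterate_sub_le hP0 hP1 hγ0 hfix (V 0) k
  -- A shift of `W k` by a constant is forgotten at the next step.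
  have hshift (k : ℕ) (b : ℝ) (hb : W k = fun y => U k y + b) :
      W (k + 1) = fun y => U (k + 1) y + -(γ * ∑ z, v z * U k z) := by
    funext x
    have h : W (k + 1) x = bellmanOp P r γ (W k) x - γ * ∑ y, v y * W k y := hW k x
    rw [h, hb, bellmanOp_add_const hP0 hP1 hγ0, sum_mul_add_const hv1, hUsucc]
    ring
  have hWU (k : ℕ) : W (k + 1) = fun y => U (k + 1) y + -(γ * ∑ z, v z * U k z) := by
    induction k with
    | zero =>
      refine hshift 0 (-(γ / (1 - γ) * ∑ y, v y * W 0 y)) (funext fun x => ?_)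
      have h := hV 0 x
      simp only [hU, Function.iterate_zero, id]
      linarith
    | succ k ih => exact hshift (k + 1) _ ih
  intro k
  cases k with
  | zero =>
    have h : 1 ≤ 2 / (1 - γ) := by rw [le_div_iff₀ hγ]; linarith
    rw [pow_zero, mul_one]
    exact le_mul_of_one_le_left (norm_nonneg _) h
  | succ k =>
    set E := ‖V 0 - Vstar‖
    have hVU (x : Fin n) : V (k + 1) x - Vstar x =
        (U (k + 1) - Vstar) x + γ / (1 - γ) *
          (∑ y, v y * (U (k + 1) - Vstar) y - ∑ y, v y * (U k - Vstar) y) := by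
      rw [hV, hWU, sum_mul_add_const hv1]
      simp only [Pi.sub_apply, mul_sub, Finset.sum_sub_distrib]
      field_simp
      ring
    refine (pi_norm_le_iff_of_nonneg (by positivity)).2 fun x => ?_
    have h₁ := (abs_sum_mul_le_norm hv0 hv1 (U (k + 1) - Vstar)).trans (hUnorm (k + 1))
    have h₂ := (abs_sum_mul_le_norm hv0 hv1 (U k - Vstar)).trans (hUnorm k)
    have h₃ := (norm_le_pi_norm (U (k + 1) - Vstar) x).trans (hUnorm (k + 1))
    rw [Pi.sub_apply, hVU]
    calc _ ≤ γ ^ (k + 1) * E + γ / (1 - γ) * (γ ^ (k + 1) * E + γ ^ k * E) := by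
          refine (norm_add_le _ _).trans (add_le_add h₃ ?_)
          rw [norm_mul, Real.norm_of_nonneg (by positivity)]
          exact mul_le_mul_of_nonneg_left ((abs_sub _ _).trans (add_le_add h₁ h₂))
            (by positivity)
      _ = 2 / (1 - γ) * γ ^ (k + 1) * E := by
          field_simp
          ring
end

section
/- Consider a finite MDP with state space of size n, a finite nonempty action set A, transition probabilities P(y | x, a) ≥ 0 with ∑_y P(y|x,a) = 1, rewards r(x,a) ∈ ℝ, and discount factor γ ∈ [0,1). Let V* ∈ ℝ^n satisfy V*(x) = max_{a} { r(x,a) + γ ∑_y P(y|x,a) V*(y) } for all x, and assume that for every state x the maximizing action a*(x) is unique; let π* be this unique optimal deterministic policy and let P^{π*} be the n×n row-stochastic matrix with entries P(y | x, π*(x)). Suppose the characteristic polynomial of P^{π*} over ℂ factors as ∏_{i=1}^n (X − λ_i) with 1 = λ_1 and |λ_2| ≥ … ≥ |λ_n|. Let v ∈ ℝ^n have nonnegative entries summing to 1, define W^{k+1}(x) = max_{a} { r(x,a) + γ ∑_y P(y|x,a) W^k(y) } − γ ∑_y v(y) W^k(y) starting from any W^0 ∈ ℝ^n, and set V^k(x)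 = W^k(x) + (γ/(1−γ)) ∑_y v(y) W^k(y). Then for every ε > 0 there exists C ≥ 0 such that ‖V^k − V*‖_∞ ≤ C (γ|λ_2| + ε)^k ‖V^0 − V*‖_∞ for all k ≥ 0. -/
open Matrix Polynomial

open Filter Asymptotics

theorem Matrix.X_sub_C_mul_charpoly_sub_vecMulVec {ι K : Type*} [Fintype ι] [DecidableEq ι]
    [Field K] [Infinite K] (M : Matrix ι ι K) (u v : ι → K) (c : K) (hM : M *ᵥ u = c • u)
    (hc : M.charpoly.IsRoot c) :
    (X - C c) * (M - vecMulVec u v).charpoly = (X - C (c - v ⬝ᵥ u)) * M.charpoly := by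
  refine Polynomial.funext fun t => ?_
  simp only [eval_mul, eval_sub, eval_X, eval_C]
  rcases eq_or_ne t c with rfl | ht
  · simp [hc.eq_zero]
  have ht' : t - c ≠ 0 := sub_ne_zero.mpr ht
  have hfac : scalar ι t - (M - vecMulVec u v) =
      (scalar ι t - M) * (1 + vecMulVec ((t - c)⁻¹ • u) v) := by
    have hu : (scalar ι t - M) *ᵥ ((t - c)⁻¹ • u) = u := by
      rw [mulVec_smul, sub_mulVec, hM]
      ext i
      simp only [scalar_apply, Pi.smul_apply, Pi.sub_apply, mulVec_diagonal, smul_eq_mul]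
      field_simp
    rw [mul_add, mul_one, mul_vecMulVec, hu]
    abel
  have hdet : (1 + vecMulVec ((t - c)⁻¹ • u) v).det = 1 + (t - c)⁻¹ * (v ⬝ᵥ u) := by
    rw [vecMulVec_eq Unit, det_one_add_replicateCol_mul_replicateRow, dotProduct_smul, smul_eq_mul]
  rw [eval_charpoly, eval_charpoly, hfac, det_mul, hdet]
  field_simp
  ring

section Gelfand

attribute [local instance] Matrix.linftyOpNormedRing Matrix.linftyOpNormedAlgebra

theorem Matrix.exists_norm_pow_mulVec_le_of_isRoot_charpoly {ι : Type*} [Fintype ι] [DecidableEq ι]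
    [Nonempty ι] (M : Matrix ι ι ℂ) {R σ : ℝ} (hR : ∀ z, M.charpoly.IsRoot z → ‖z‖ ≤ R)
    (hRσ : R < σ) (hσ : 0 < σ) :
    ∃ B, 0 ≤ B ∧ ∀ (k : ℕ) (x : ι → ℂ), ‖(M ^ k) *ᵥ x‖ ≤ B * σ ^ k * ‖x‖ := by
  lift σ to NNReal using hσ.le
  have hrad : spectralRadius ℂ M < σ := by
    refine spectrum.spectralRadius_lt_of_forall_lt M fun z hz => ?_
    rw [← NNReal.coe_lt_coe, coe_nnnorm]
    exact (hR z (mem_spectrum_iff_isRoot_charpoly.mp hz)).trans_lt hRσ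
  have hO : (fun k => M ^ k) =O[atTop] fun k => (σ : ℝ) ^ k := by
    refine IsBigO.of_bound 1 ?_
    filter_upwards [(spectrum.pow_nnnorm_pow_one_div_tendsto_nhds_spectralRadius M).eventually_lt
      tendsto_const_nhds hrad, eventually_gt_atTop 0] with k hk hk0
    rw [one_div, ENNReal.rpow_inv_lt_iff (by positivity), ENNReal.rpow_natCast] at hk
    have hk' : ‖M ^ k‖₊ < σ ^ k := by exact_mod_cast hk
    rw [one_mul, Real.norm_of_nonneg (by positivity)]
    exact_mod_cast hk'.le
  obtain ⟨B, hB, hbound⟩ := bound_of_isBigO_nat_atTop hO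
  refine ⟨B, hB.le, fun k x => (linfty_opNorm_mulVec _ _).trans ?_⟩
  gcongr
  simpa using hbound (pow_ne_zero k hσ.ne')

end Gelfand

theorem Finset.abs_sup'_sub_sup'_le {α : Type*} {s : Finset α} (hs : s.Nonempty) {f g : α → ℝ}
    {c : ℝ} (h : ∀ a ∈ s, |f a - g a| ≤ c) : |s.sup' hs f - s.sup' hs g| ≤ c := by
  rw [abs_sub_le_iff, sub_le_iff_le_add, sub_le_iff_le_add]
  constructor <;> refine Finset.sup'_le _ _ fun a ha => ?_
  · linarith [(abs_sub_le_iff.mp (h a ha)).1, Finset.le_sup' g ha]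
  · linarith [(abs_sub_le_iff.mp (h a ha)).2, Finset.le_sup' f ha]

theorem Finset.sup'_add_const {α : Type*} {s : Finset α} (hs : s.Nonempty) (f : α → ℝ) (c : ℝ) :
    s.sup' hs (fun a => f a + c) = s.sup' hs f + c := by
  refine le_antisymm (Finset.sup'_le _ _ fun a ha => by gcongr; exact Finset.le_sup' f ha) ?_
  rw [← le_sub_iff_add_le]
  refine Finset.sup'_le _ _ fun a ha => ?_
  rw [le_sub_iff_add_le]
  exact Finset.le_sup' (fun a => f a + c) ha

theorem abs_sum_mul_le_of_stochastic {ι : Type*} [Fintype ι] {p f : ι → ℝ} {c : ℝ}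
    (hp0 : ∀ y, 0 ≤ p y) (hp1 : ∑ y, p y = 1) (hf : ∀ y, |f y| ≤ c) : |∑ y, p y * f y| ≤ c :=
  calc |∑ y, p y * f y| ≤ ∑ y, |p y * f y| := Finset.abs_sum_le_sum_abs _ _
    _ ≤ ∑ y, p y * c := by
      gcongr with y
      rw [abs_mul, abs_of_nonneg (hp0 y)]
      exact mul_le_mul_of_nonneg_left (hf y) (hp0 y)
    _ = c := by rw [← Finset.sum_mul, hp1, one_mul]

/-- The Bellman optimality operator of a finite Markov decision process. -/
noncomputable def bellman {ι A : Type*} [Fintype ι] [Fintype A] [Nonempty A]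
    (P : ι → A → ι → ℝ) (r : ι → A → ℝ) (γ : ℝ) (U : ι → ℝ) : ι → ℝ := fun x =>
  Finset.univ.sup' Finset.univ_nonempty (fun a => r x a + γ * ∑ y, P x a y * U y)

section Bellman

variable {ι A : Type*} [Fintype ι] [Fintype A] [Nonempty A] {P : ι → A → ι → ℝ}
  {r : ι → A → ℝ} {γ : ℝ}

theorem bellman_add_const (hP1 : ∀ x a, ∑ y, P x a y = 1) (U : ι → ℝ) (c : ℝ) (x : ι) :
    bellman P r γ (fun y => U y + c) x = bellman P r γ U x + γ * c := by
  rw [bellman, bellman, ← Finset.sup'_add_const]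
  congr 1
  ext a
  simp only [mul_add, Finset.sum_add_distrib, ← Finset.sum_mul, hP1]
  ring

theorem abs_bellman_sub_bellman_le (hP0 : ∀ x a y, 0 ≤ P x a y) (hP1 : ∀ x a, ∑ y, P x a y = 1)
    (hγ0 : 0 ≤ γ) {U U' : ι → ℝ} {c : ℝ} (h : ∀ y, |U y - U' y| ≤ c) (x : ι) :
    |bellman P r γ U x - bellman P r γ U' x| ≤ γ * c := by
  refine Finset.abs_sup'_sub_sup'_le _ fun a _ => ?_
  rw [add_sub_add_left_eq_sub, ← mul_sub, ← Finset.sum_sub_distrib, abs_mul, abs_of_nonneg hγ0]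
  simp only [← mul_sub]
  gcongr
  exact abs_sum_mul_le_of_stochastic (hP0 x a) (hP1 x a) h

theorem tendsto_iterate_bellman (hP0 : ∀ x a y, 0 ≤ P x a y) (hP1 : ∀ x a, ∑ y, P x a y = 1)
    (hγ0 : 0 ≤ γ) (hγ1 : γ < 1) {Vstar : ι → ℝ} (hVstar : bellman P r γ Vstar = Vstar)
    (U : ι → ℝ) (x : ι) :
    Tendsto (fun k => (bellman P r γ)^[k] U x) atTop (nhds (Vstar x)) := by
  have hbound : ∀ k x, |(bellman P r γ)^[k] U x - Vstar x| ≤ γ ^ k * ‖U - Vstar‖ := by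
    intro k
    induction k with
    | zero => intro x; simpa using norm_le_pi_norm (U - Vstar) x
    | succ k ih =>
      intro x
      have h := abs_bellman_sub_bellman_le (r := r) hP0 hP1 hγ0 ih x
      rw [hVstar] at h
      rw [Function.iterate_succ_apply', pow_succ', mul_assoc]
      exact h
  rw [tendsto_iff_norm_sub_tendsto_zero]
  refine squeeze_zero (fun _ => norm_nonneg _) (fun k => hbound k x) ?_
  simpa using (tendsto_pow_atTop_nhds_zero_of_lt_one hγ0 hγ1).mul_const ‖U - Vstar‖

/-- If the optimal policy is unique, it is eventually greedy along any sequence that differs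
from value iteration by a scalar sequence. -/
theorem eventually_bellman_eq_of_unique (hP0 : ∀ x a y, 0 ≤ P x a y)
    (hP1 : ∀ x a, ∑ y, P x a y = 1) (hγ0 : 0 ≤ γ) (hγ1 : γ < 1) {Vstar : ι → ℝ}
    (hVstar : bellman P r γ Vstar = Vstar) {pistar : ι → A}
    (hpistar : ∀ x, r x (pistar x) + γ * ∑ y, P x (pistar x) y * Vstar y = Vstar x ∧
      ∀ a, r x a + γ * ∑ y, P x a y * Vstar y = Vstar x → a = pistar x)
    {W : ℕ → ι → ℝ} {s : ℕ → ℝ} (hW : ∀ k x, W (k + 1) x = bellman P r γ (W k) x - s k) :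
    ∀ᶠ k in atTop, ∀ x, bellman P r γ (W k) x =
      r x (pistar x) + γ * ∑ y, P x (pistar x) y * W k y := by
  have hshift : ∀ k, ∃ c, ∀ x, W k x = (bellman P r γ)^[k] (W 0) x + c := by
    intro k
    induction k with
    | zero => exact ⟨0, fun x => by simp⟩
    | succ k ih =>
      obtain ⟨c, hc⟩ := ih
      refine ⟨γ * c - s k, fun x => ?_⟩
      rw [hW, funext hc, bellman_add_const hP1, Function.iterate_succ_apply', add_sub_assoc]
  have hq : ∀ x a, Tendsto
      (fun k => r x a + γ * ∑ y, P x a y * (bellman P r γ)^[k] (W 0) y) atTop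
      (nhds (r x a + γ * ∑ y, P x a y * Vstar y)) := fun x a =>
    ((tendsto_finsetSum _ fun y _ =>
      (tendsto_iterate_bellman hP0 hP1 hγ0 hγ1 hVstar (W 0) y).const_mul _).const_mul _).const_add _
  have hgreedy : ∀ᶠ k in atTop, ∀ x a,
      r x a + γ * ∑ y, P x a y * (bellman P r γ)^[k] (W 0) y ≤
        r x (pistar x) + γ * ∑ y, P x (pistar x) y * (bellman P r γ)^[k] (W 0) y := by
    refine eventually_all.mpr fun x => eventually_all.mpr fun a => ?_
    by_cases ha : a = pistar x
    · subst ha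
      exact Eventually.of_forall fun _ => le_rfl
    · have hle : r x a + γ * ∑ y, P x a y * Vstar y ≤ Vstar x := by
        conv_rhs => rw [← hVstar]
        exact Finset.le_sup' (fun a => r x a + γ * ∑ y, P x a y * Vstar y) (Finset.mem_univ a)
      have hlt := lt_of_le_of_ne hle fun h => ha ((hpistar x).2 a h)
      rw [← (hpistar x).1] at hlt
      exact ((hq x a).eventually_lt (hq x (pistar x)) hlt).mono fun _ h => h.le
  filter_upwards [hgreedy] with k hk x
  obtain ⟨c, hc⟩ := hshift k
  refine le_antisymm (Finset.sup'_le _ _ fun a _ => ?_)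
    (Finset.le_sup' (fun a => r x a + γ * ∑ y, P x a y * W k y) (Finset.mem_univ _))
  simp only [hc, mul_add, Finset.sum_add_distrib, ← Finset.sum_mul, hP1]
  linarith [hk x a]

end Bellman

/-- **Rank-1 DDVI for Control: asymptotic `Õ((γ|λ₂|)^k)` rate under a unique optimal
policy.** If the optimal action is unique at every state, `π*` is the optimal policy and
the eigenvalues of `P^{π*}` are `1 = λ₁, λ₂, …, λₙ` with `|λ₂| ≥ … ≥ |λₙ|`, then the
rank-1 DDVI for Control iterates satisfy
`‖V^k - V*‖ = Õ((γ|λ₂|)^k ‖V⁰ - V*‖)`. -/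
theorem rank1_ddvi_control_asymptotic_rate {n : ℕ} (hn : 1 < n)
    {A : Type*} [Fintype A] [Nonempty A]
    (P : Fin n → A → Fin n → ℝ)
    (hP0 : ∀ x a y, 0 ≤ P x a y) (hP1 : ∀ x a, ∑ y, P x a y = 1)
    (r : Fin n → A → ℝ)
    (γ : ℝ) (hγ0 : 0 ≤ γ) (hγ1 : γ < 1)
    (Vstar : Fin n → ℝ)
    (hVstar : ∀ x, Vstar x = Finset.univ.sup' Finset.univ_nonempty
        (fun a => r x a + γ * ∑ y, P x a y * Vstar y))
    (pistar : Fin n → A)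
    (hpistar : ∀ x, r x (pistar x) + γ * ∑ y, P x (pistar x) y * Vstar y = Vstar x ∧
        ∀ a, r x a + γ * ∑ y, P x a y * Vstar y = Vstar x → a = pistar x)
    (Pstar : Matrix (Fin n) (Fin n) ℂ)
    (hPstar : Pstar = Matrix.of fun x y => ((P x (pistar x) y : ℝ) : ℂ))
    (lam : Fin n → ℂ)
    (hchar : Pstar.charpoly = ∏ i : Fin n, (X - C (lam i)))
    (hlam1 : lam ⟨0, Nat.lt_of_lt_of_le Nat.zero_lt_one hn.le⟩ = 1)
    (hord : ∀ i j : Fin n, 0 < (i : ℕ) → i ≤ j → ‖lam j‖ ≤ ‖lam i‖)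
    (v : Fin n → ℝ) (hv0 : ∀ y, 0 ≤ v y) (hv1 : ∑ y, v y = 1)
    (W : ℕ → Fin n → ℝ)
    (hW : ∀ k x, W (k + 1) x = Finset.univ.sup' Finset.univ_nonempty
        (fun a => r x a + γ * ∑ y, P x a y * W k y) - γ * ∑ y, v y * W k y)
    (V : ℕ → Fin n → ℝ)
    (hV : ∀ k x, V k x = W k x + γ / (1 - γ) * ∑ y, v y * W k y) :
    ∀ ε > 0, ∃ C ≥ 0, ∀ k : ℕ,
      ‖V k - Vstar‖ ≤ C * (γ * ‖lam ⟨1, hn⟩‖ + ε) ^ k * ‖V 0 - Vstar‖ := by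
  intro ε hε
  have hn0 : 0 < n := Nat.zero_lt_of_lt hn
  have : Nonempty (Fin n) := ⟨⟨0, hn0⟩⟩
  have hVb : bellman P r γ Vstar = Vstar := funext fun x => (hVstar x).symm
  have hγ' : (1 - γ) ≠ 0 := (sub_pos.mpr hγ1).ne'
  set ρ : ℝ := γ * ‖lam ⟨1, hn⟩‖ + ε with hρ
  have hρ0 : 0 < ρ := by positivity
  -- the deflated fixed point and the error of the `W`-iterates
  set s : ℝ := ∑ y, v y * Vstar y with hs
  set d : ℕ → Fin n → ℝ := fun k x => W k x - (Vstar x - γ * s) with hd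
  have hvd : ∀ k, ∑ y, v y * W k y = ∑ y, v y * d k y + (1 - γ) * s := by
    intro k
    simp only [hd, mul_sub, Finset.sum_sub_distrib, ← Finset.sum_mul, hv1, ← hs]
    ring
  have hVd : ∀ k x, V k x - Vstar x = d k x + γ / (1 - γ) * ∑ y, v y * d k y := by
    intro k x
    rw [hV, hvd]
    simp only [hd]
    field_simp
    ring
  by_cases h0 : V 0 = Vstar
  · have hvd0 : ∑ y, v y * d 0 y = 0 := by
      have h : ∀ y, v y * d 0 y = v y * -(γ / (1 - γ) * ∑ z, v z * d 0 z) := fun y => by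
        have := hVd 0 y
        rw [h0, sub_self] at this
        rw [← eq_neg_of_add_eq_zero_left this.symm]
      have h2 := Finset.sum_congr rfl fun y (_ : y ∈ Finset.univ) => h y
      rw [← Finset.sum_mul, hv1, one_mul] at h2
      field_simp at h2
      linarith
    have hd0 : ∀ k, d k = 0 := by
      intro k
      induction k with
      | zero =>
        ext x
        have := hVd 0 x
        rw [h0, hvd0] at this
        simpa using this.symm
      | succ k ih =>
        have hWk : W k = fun y => Vstar y + -(γ * s) := by
          ext y
          have := congrFun ih y
          simp only [hd, Pi.zero_apply] at this
          linarith
        ext x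
        have hstep : W (k + 1) x = bellman P r γ (W k) x - γ * ∑ y, v y * W k y := hW k x
        simp only [hd, Pi.zero_apply]
        rw [hstep, hvd, ih, hWk, bellman_add_const hP1, hVb]
        simp only [Pi.zero_apply, mul_zero, Finset.sum_const_zero]
        ring
    refine ⟨0, le_rfl, fun k => ?_⟩
    have : V k = Vstar := by
      ext x
      have := hVd k x
      rw [hd0] at this
      simpa [sub_eq_zero] using this
    simp [this]
  -- the deflated matrix and its spectrum
  set vc : Fin n → ℂ := fun y => (v y : ℂ) with hvc
  set N : Matrix (Fin n) (Fin n) ℂ := Pstar - vecMulVec (fun _ => 1) vc with hN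
  have hroots : ∀ z, N.charpoly.IsRoot z → ‖z‖ ≤ ‖lam ⟨1, hn⟩‖ := by
    have hsplit : Pstar.charpoly =
        (X - C 1) * ∏ i ∈ Finset.univ.erase (⟨0, hn0⟩ : Fin n), (X - C (lam i)) := by
      rw [hchar, ← Finset.mul_prod_erase _ _ (Finset.mem_univ (⟨0, hn0⟩ : Fin n)), hlam1]
    have hone : Pstar *ᵥ (fun _ => 1) = (1 : ℂ) • fun _ => 1 := by
      ext x
      simp only [hPstar, mulVec, dotProduct, of_apply, mul_one, Pi.smul_apply, smul_eq_mul]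
      exact_mod_cast hP1 x (pistar x)
    have hvone : vc ⬝ᵥ (fun _ => 1) = 1 := by
      simp only [hvc, dotProduct, mul_one]
      exact_mod_cast hv1
    have hmul := X_sub_C_mul_charpoly_sub_vecMulVec Pstar (fun _ => 1) vc 1 hone
      (by simp [hsplit])
    rw [hvone, hsplit, mul_left_comm] at hmul
    have hNchar := mul_left_cancel₀ (X_sub_C_ne_zero (1 : ℂ)) hmul
    intro z hz
    rw [← hN] at hNchar
    rw [hNchar, IsRoot, eval_mul, eval_prod, mul_eq_zero, Finset.prod_eq_zero_iff] at hz
    rcases hz with hz | ⟨i, hi, hz⟩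
    · have : z = 0 := by simpa using hz
      simp [this]
    · have hzi : z = lam i := by simpa [sub_eq_zero] using hz
      have hi0 : 0 < (i : ℕ) := by
        refine Nat.pos_of_ne_zero fun h => (Finset.mem_erase.mp hi).1 (Fin.ext h)
      rw [hzi]
      exact hord ⟨1, hn⟩ i one_pos hi0
  obtain ⟨B, hB0, hB⟩ := exists_norm_pow_mulVec_le_of_isRoot_charpoly N hroots
    (lt_add_of_pos_right _ hε) (by positivity)
  -- after finitely many steps the error evolves linearly
  obtain ⟨K, hK⟩ := eventually_atTop.mp
    (eventually_bellman_eq_of_unique hP0 hP1 hγ0 hγ1 hVb hpistar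
      (W := W) (s := fun k => γ * ∑ y, v y * W k y) hW)
  set D : ℕ → Fin n → ℂ := fun k x => (d k x : ℂ) with hD
  have hDnorm : ∀ k, ‖D k‖ = ‖d k‖ := fun k => by
    simp [hD, Pi.norm_def, nnnorm]
  have hlin : ∀ k ≥ K, D (k + 1) = (γ : ℂ) • (N *ᵥ D k) := by
    intro k hk
    have hreal : ∀ x, d (k + 1) x =
        γ * (∑ y, P x (pistar x) y * d k y - ∑ y, v y * d k y) := by
      intro x
      have hstep : W (k + 1) x = bellman P r γ (W k) x - γ * ∑ y, v y * W k y := hW k x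
      have hPd : ∑ y, P x (pistar x) y * W k y = ∑ y, P x (pistar x) y * d k y +
          ∑ y, P x (pistar x) y * Vstar y - γ * s := by
        simp only [hd, mul_sub, Finset.sum_sub_distrib, ← Finset.sum_mul, hP1]
        ring
      have hfix := (hpistar x).1
      rw [hK k hk x, hvd, hPd] at hstep
      simp only [hd] at hstep ⊢
      linear_combination hstep + hfix
    ext x
    simp only [hD, hreal x, hN, hPstar, hvc, sub_mulVec, Pi.smul_apply, Pi.sub_apply, smul_eq_mul,
      mulVec, dotProduct, of_apply, vecMulVec_apply, one_mul]
    push_cast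
    rfl
  have hpow : ∀ j, D (K + j) = (γ : ℂ) ^ j • ((N ^ j) *ᵥ D K) := by
    intro j
    induction j with
    | zero => simp
    | succ j ih =>
      rw [← add_assoc, hlin _ (Nat.le_add_right K j), ih, mulVec_smul, smul_smul, mulVec_mulVec,
        pow_succ' (γ : ℂ), pow_succ' N]
  have hdecay : ∀ j, ‖d (K + j)‖ ≤ B * ‖d K‖ * ρ ^ j := by
    intro j
    rw [← hDnorm, hpow, norm_smul, norm_pow, Complex.norm_real, Real.norm_of_nonneg hγ0]
    have hrate : γ * (‖lam ⟨1, hn⟩‖ + ε) ≤ ρ := by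
      rw [hρ, mul_add]
      gcongr
      exact mul_le_of_le_one_left hε.le hγ1.le
    calc γ ^ j * ‖(N ^ j) *ᵥ D K‖
        ≤ γ ^ j * (B * (‖lam ⟨1, hn⟩‖ + ε) ^ j * ‖D K‖) := by gcongr; exact hB j _
      _ = B * ‖d K‖ * (γ * (‖lam ⟨1, hn⟩‖ + ε)) ^ j := by rw [hDnorm, mul_pow]; ring
      _ ≤ B * ‖d K‖ * ρ ^ j := by gcongr
  -- transfer to `V`
  have hVnorm : ∀ k, ‖V k - Vstar‖ ≤ (1 + γ / (1 - γ)) * ‖d k‖ := by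
    have hq : 0 ≤ γ / (1 - γ) := div_nonneg hγ0 (sub_pos.mpr hγ1).le
    intro k
    refine (pi_norm_le_iff_of_nonneg (by positivity)).mpr fun x => ?_
    rw [Pi.sub_apply, hVd, add_mul, one_mul]
    refine (norm_add_le _ _).trans (add_le_add (norm_le_pi_norm _ x) ?_)
    rw [norm_mul, Real.norm_of_nonneg hq]
    gcongr
    exact abs_sum_mul_le_of_stochastic hv0 hv1 fun y => norm_le_pi_norm (d k) y
  have hO : (fun k => V k - Vstar) =O[atTop] fun k => ρ ^ k := by
    have hdO : d =O[atTop] fun k => ρ ^ k := by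
      refine IsBigO.of_bound (B * ‖d K‖ / ρ ^ K) ?_
      filter_upwards [eventually_ge_atTop K] with k hk
      obtain ⟨j, rfl⟩ := Nat.exists_eq_add_of_le hk
      refine (hdecay j).trans_eq ?_
      rw [Real.norm_of_nonneg (by positivity), pow_add]
      field_simp
    exact (IsBigO.of_bound _ (Eventually.of_forall hVnorm)).trans hdO
  obtain ⟨c, hc, hbound⟩ := bound_of_isBigO_nat_atTop hO
  have hpos : 0 < ‖V 0 - Vstar‖ := norm_pos_iff.mpr (sub_ne_zero.mpr h0)
  refine ⟨c / ‖V 0 - Vstar‖, by positivity, fun k => ?_⟩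
  have h := hbound (pow_ne_zero k hρ0.ne')
  rw [Real.norm_of_nonneg (by positivity)] at h
  refine h.trans_eq ?_
  field_simp
end

section
/- Consider a finite MDP with state space of size n, a finite nonempty action set A, transition probabilities P(y | x, a) ≥ 0 with ∑_y P(y|x,a) = 1, rewards r(x,a) ∈ ℝ, and discount factor γ ∈ [0,1). Let v ∈ ℝ^n have nonnegative entries summing to 1. Define the rank-1 DDVI for Control iterates by W^{k+1}(x) = max_{a} { r(x,a) + γ ∑_y P(y|x,a) W^k(y) } − γ ∑_y v(y) W^k(y), and the value iteration iterates by U^{k+1}(x) = max_{a} { r(x,a) + γ ∑_y P(y|x,a) U^k(y) }. If W^0 = U^0, then for every k ≥ 0 there exists a constant c_k ∈ ℝ such that W^k = U^k + c_k·1, where 1 is the all-ones vector. Consequently, for every k and every state x, an action a maximizes r(x,a) + γ ∑_y P(y|x,a) W^k(y) if and only if it maximizes r(x,a) + γ ∑_y P(y|x,a) U^k(y); i.e., rank-1 DDVI for Control produces the same greedy policies as value iteration. -/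
/-- Shifting the value function by a constant shifts every action value by `γ` times it. -/
lemma bellman_add_const_s11 {ι : Type*} [Fintype ι] (p : ι → ℝ) (hp : ∑ y, p y = 1)
    (r γ c : ℝ) (u : ι → ℝ) :
    r + γ * ∑ y, p y * (u y + c) = (r + γ * ∑ y, p y * u y) + γ * c := by
  simp only [mul_add, Finset.sum_add_distrib, ← Finset.sum_mul, hp]
  ring

/-- **Rank-1 DDVI for Control produces the same greedy policies as value iteration.**
If `W⁰ = U⁰`, then each rank-1 DDVI iterate `W^k` differs from the value iteration
iterate `U^k` by a constant vector, and hence for every `k` and state `x` an action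
maximizes `r(x,a) + γ ∑_y P(y|x,a) W^k(y)` iff it maximizes
`r(x,a) + γ ∑_y P(y|x,a) U^k(y)`. -/
theorem rank1_ddvi_control_same_greedy {n : ℕ} {A : Type*} [Fintype A] [Nonempty A]
    (P : Fin n → A → Fin n → ℝ)
    (hP0 : ∀ x a y, 0 ≤ P x a y) (hP1 : ∀ x a, ∑ y, P x a y = 1)
    (r : Fin n → A → ℝ)
    (γ : ℝ) (hγ0 : 0 ≤ γ) (hγ1 : γ < 1)
    (v : Fin n → ℝ) (hv0 : ∀ y, 0 ≤ v y) (hv1 : ∑ y, v y = 1)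
    (W U : ℕ → Fin n → ℝ)
    (hW : ∀ k x, W (k + 1) x = Finset.univ.sup' Finset.univ_nonempty
        (fun a => r x a + γ * ∑ y, P x a y * W k y) - γ * ∑ y, v y * W k y)
    (hU : ∀ k x, U (k + 1) x = Finset.univ.sup' Finset.univ_nonempty
        (fun a => r x a + γ * ∑ y, P x a y * U k y))
    (h0 : W 0 = U 0) :
    (∀ k : ℕ, ∃ c : ℝ, W k = fun x => U k x + c) ∧
      ∀ (k : ℕ) (x : Fin n) (a : A),
        ((∀ b, r x b + γ * ∑ y, P x b y * W k y ≤ r x a + γ * ∑ y, P x a y * W k y) ↔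
          (∀ b, r x b + γ * ∑ y, P x b y * U k y ≤ r x a + γ * ∑ y, P x a y * U k y)) := by
  have key : ∀ k : ℕ, ∃ c : ℝ, W k = fun x => U k x + c := by
    intro k
    induction k with
    | zero => exact ⟨0, by simp [h0]⟩
    | succ k ih =>
      obtain ⟨c, hc⟩ := ih
      refine ⟨γ * c - γ * ∑ y, v y * W k y, funext fun x => ?_⟩
      rw [hW, hU, add_sub, Finset.sup'_add]
      simp only [hc, bellman_add_const_s11 _ (hP1 x _)]
  refine ⟨key, fun k x a => ?_⟩
  obtain ⟨c, hc⟩ := key k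
  simp only [hc, bellman_add_const_s11 _ (hP1 x _), add_le_add_iff_right]
end

section
/- Let P be an n×n complex matrix, γ ∈ ℂ, r ∈ ℂ^n, let λ_1,…,λ_s ∈ ℂ and u_1,…,u_s ∈ ℂ^n satisfy P u_i = λ_i u_i, let v_1,…,v_s ∈ ℂ^n satisfy v_iᴴ u_i = 1 and v_iᴴ u_j = 0 for i ≠ j, with γλ_i ≠ 1 for all i, and set E_s = ∑_{i=1}^s λ_i u_i v_iᴴ. Define the α = 1 DDVI iterates by V^0 = 0, W^{k+1} = γ(P − E_s) V^k + r, and V^{k+1} = (I − γE_s)^{−1} W^{k+1}. Then for every k ≥ 1, W^k = ∑_{i=0}^{k−1} γ^i (P − E_s)^i r; in particular W^{k+1} − W^k = γ^k (P − E_s)^k r, so the normalized differences (W^{k+1} − W^k)/γ^k are exactly the power-iteration vectors of the deflated matrix P − E_s started at r. -/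
open Matrix

section Deflation

variable {m ι K : Type*} [Fintype m] [Fintype ι] [Field K]

/-- Right eigenvectors are eigenvectors of the spectral sum built from a biorthogonal system. -/
theorem sum_smul_vecMulVec_mulVec [DecidableEq ι] (lam : ι → K) (u w : ι → m → K)
    (hbi : ∀ i j, w i ⬝ᵥ u j = if i = j then 1 else 0) (j : ι) :
    (∑ i, lam i • vecMulVec (u i) (w i)) *ᵥ u j = lam j • u j := by
  simp [sum_mulVec, smul_mulVec, vecMulVec_mulVec, hbi, ite_smul]

/-- `1 - γ E` is invertible when `E = ∑ λᵢ uᵢ wᵢᵀ` is a biorthogonal spectral sum and no `γ λᵢ`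
equals `1`. -/
theorem isUnit_one_sub_smul_of_spectral_sum [DecidableEq m] (γ : K) (lam : ι → K)
    (u w : ι → m → K) {E : Matrix m m K} (hE : E = ∑ i, lam i • vecMulVec (u i) (w i))
    (hEu : ∀ i, E *ᵥ u i = lam i • u i) (hγ : ∀ i, γ * lam i ≠ 1) :
    IsUnit (1 - γ • E) := by
  have key : (1 - γ • E) * ∑ i, (γ * lam i / (1 - γ * lam i)) • vecMulVec (u i) (w i) =
      γ • E := by
    conv_rhs => rw [hE, Finset.smul_sum]
    rw [Finset.mul_sum]
    refine Finset.sum_congr rfl fun i _ => ?_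
    have h : 1 - γ * lam i ≠ 0 := sub_ne_zero.mpr (hγ i).symm
    have hu : (1 - γ • E) *ᵥ u i = (1 - γ * lam i) • u i := by
      rw [sub_mulVec, one_mulVec, smul_mulVec, hEu, sub_smul, one_smul, smul_smul]
    rw [mul_smul_comm, mul_vecMulVec, hu, smul_vecMulVec, smul_smul, smul_smul,
      div_mul_cancel₀ _ h]
  refine IsUnit.of_mul_eq_one
    (1 + ∑ i, (γ * lam i / (1 - γ * lam i)) • vecMulVec (u i) (w i)) ?_
  rw [mul_add, key, mul_one, sub_add_cancel]

/-- If every `uᵢ` is annihilated by `A`, so is the spectral sum `∑ λᵢ uᵢ wᵢᵀ`. -/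
theorem mul_spectral_sum_eq_zero (A : Matrix m m K) (lam : ι → K) (u w : ι → m → K)
    (hA : ∀ i, A *ᵥ u i = 0) : A * ∑ i, lam i • vecMulVec (u i) (w i) = 0 := by
  simp [Finset.mul_sum, mul_vecMulVec, hA]

/-- If `A E = 0`, then right multiplication by `(1 - γ E)⁻¹` fixes `A`. -/
theorem mul_one_sub_smul_inv_of_mul_eq_zero [DecidableEq m] {A E : Matrix m m K} {γ : K}
    (hAE : A * E = 0) (hunit : IsUnit (1 - γ • E)) : A * (1 - γ • E)⁻¹ = A := by
  have hA : A * (1 - γ • E) = A := by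
    rw [mul_sub, mul_one, mul_smul_comm, hAE, smul_zero, sub_zero]
  conv_lhs => rw [← hA]
  exact mul_nonsing_inv_cancel_right _ _ ((isUnit_iff_isUnit_det _).mp hunit)

end Deflation

/-- The affine iteration `x ↦ c A x + r` started at `r` produces truncated Neumann sums. -/
theorem affine_iterate_eq_sum {m K : Type*} [Fintype m] [DecidableEq m] [CommRing K]
    (A : Matrix m m K) (c : K) (r : m → K) (x : ℕ → m → K) (h0 : x 0 = r)
    (hx : ∀ k, x (k + 1) = c • A *ᵥ x k + r) (k : ℕ) :
    x k = ∑ i ∈ Finset.range (k + 1), c ^ i • (A ^ i) *ᵥ r := by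
  induction k with
  | zero => simp [h0]
  | succ k ih =>
    rw [hx, ih, Finset.sum_range_succ' _ (k + 1), mulVec_sum, Finset.smul_sum]
    simp only [pow_zero, one_mulVec, one_smul]
    congr 1
    refine Finset.sum_congr rfl fun i _ => ?_
    rw [mulVec_smul, mulVec_mulVec, smul_smul, ← pow_succ', ← pow_succ']

/-- **DDVI iterates as power iteration of the deflated matrix.** With `α = 1`, `V⁰ = 0`,
`W^{k+1} = γ(P - Eₛ)V^k + r` and `V^{k+1} = (I - γEₛ)⁻¹ W^{k+1}`, one has
`W^k = ∑_{i<k} γ^i (P-Eₛ)^i r` for `k ≥ 1`; in particular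
`W^{k+1} - W^k = γ^k (P-Eₛ)^k r`. -/
theorem ddvi_iterates_power_iteration {n s : ℕ} (P : Matrix (Fin n) (Fin n) ℂ)
    (γ : ℂ) (r : Fin n → ℂ)
    (lam : Fin s → ℂ) (u v : Fin s → Fin n → ℂ)
    (hu : ∀ i : Fin s, P.mulVec (u i) = lam i • u i)
    (hbi : ∀ i j : Fin s, star (v i) ⬝ᵥ u j = if i = j then 1 else 0)
    (hγ : ∀ i : Fin s, γ * lam i ≠ 1)
    (E : Matrix (Fin n) (Fin n) ℂ)
    (hE : E = ∑ i : Fin s, lam i • vecMulVec (u i) (star (v i)))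
    (V W : ℕ → Fin n → ℂ)
    (hV0 : V 0 = 0)
    (hW : ∀ k : ℕ, W (k + 1) = γ • (P - E).mulVec (V k) + r)
    (hV : ∀ k : ℕ, V (k + 1) = ((1 : Matrix (Fin n) (Fin n) ℂ) - γ • E)⁻¹.mulVec (W (k + 1))) :
    (∀ k : ℕ, 1 ≤ k → W k = ∑ i ∈ Finset.range k, γ ^ i • ((P - E) ^ i).mulVec r) ∧
      ∀ k : ℕ, 1 ≤ k → W (k + 1) - W k = γ ^ k • ((P - E) ^ k).mulVec r := by
  have hEu : ∀ j, E *ᵥ u j = lam j • u j := fun j => by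
    rw [hE]
    exact sum_smul_vecMulVec_mulVec lam u (fun i => star (v i)) hbi j
  have hunit : IsUnit (1 - γ • E) :=
    isUnit_one_sub_smul_of_spectral_sum γ lam u (fun i => star (v i)) hE hEu hγ
  have hAE : (P - E) * E = 0 := by
    refine (congrArg ((P - E) * ·) hE).trans
      (mul_spectral_sum_eq_zero _ lam u (fun i => star (v i)) fun i => ?_)
    rw [sub_mulVec, hu, hEu, sub_self]
  have hstep : ∀ k, W (k + 1 + 1) = γ • (P - E) *ᵥ W (k + 1) + r := fun k => by
    rw [hW, hV, mulVec_mulVec, mul_one_sub_smul_inv_of_mul_eq_zero hAE hunit]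
  have hsum : ∀ k, 1 ≤ k → W k = ∑ i ∈ Finset.range k, γ ^ i • ((P - E) ^ i) *ᵥ r := by
    intro k hk
    obtain ⟨k, rfl⟩ := Nat.exists_eq_add_of_le' hk
    exact affine_iterate_eq_sum (P - E) γ r (fun k => W (k + 1)) (by simp [hW, hV0]) hstep k
  refine ⟨hsum, fun k hk => ?_⟩
  rw [hsum (k + 1) (by omega), hsum k hk, Finset.sum_range_succ, add_sub_cancel_left]
end

section
/- Let P be an n×n complex matrix, let λ_1,…,λ_s ∈ ℂ and u_1,…,u_s ∈ ℂ^n satisfy P u_i = λ_i u_i, let v_1,…,v_s ∈ ℂ^n satisfy v_iᴴ u_i = 1 and v_iᴴ u_j = 0 for i ≠ j, and set E_s = ∑_{i=1}^s λ_i u_i v_iᴴ. Suppose w ∈ ℂ^n is an eigenvector of the deflated matrix: (P − E_s) w = μ w, where μ ∉ {λ_1,…,λ_s}. Then the vector u = w − ∑_{i=1}^s (λ_i (v_iᴴ w)/(λ_i − μ)) u_i is an eigenvector of P with eigenvalue μ: P u = μ u. -/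
open Matrix

/-- **Eigenvector recovery after deflation.** If `Eₛ = ∑ λᵢ uᵢ vᵢᴴ` with `P uᵢ = λᵢ uᵢ`
and `vᵢᴴ uⱼ = δᵢⱼ`, and `w` is an eigenvector of `P - Eₛ` with eigenvalue
`μ ∉ {λ₁,…,λₛ}`, then `u = w - ∑ (λᵢ (vᵢᴴ w)/(λᵢ - μ)) uᵢ` is an eigenvector of `P` with
eigenvalue `μ`. -/
theorem deflation_eigenvector_recovery {n s : ℕ} (P : Matrix (Fin n) (Fin n) ℂ)
    (lam : Fin s → ℂ) (u v : Fin s → Fin n → ℂ)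
    (hu : ∀ i : Fin s, P.mulVec (u i) = lam i • u i)
    (hbi : ∀ i j : Fin s, star (v i) ⬝ᵥ u j = if i = j then 1 else 0)
    (E : Matrix (Fin n) (Fin n) ℂ)
    (hE : E = ∑ i : Fin s, lam i • vecMulVec (u i) (star (v i)))
    (w : Fin n → ℂ) (μ : ℂ)
    (hw : (P - E).mulVec w = μ • w)
    (hμ : ∀ i : Fin s, μ ≠ lam i) :
    P.mulVec (w - ∑ i : Fin s, (lam i * (star (v i) ⬝ᵥ w) / (lam i - μ)) • u i) =
      μ • (w - ∑ i : Fin s, (lam i * (star (v i) ⬝ᵥ w) / (lam i - μ)) • u i) := by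
  have hEw : E.mulVec w = ∑ i, (lam i * (star (v i) ⬝ᵥ w)) • u i := by
    simp [hE, sum_mulVec, smul_mulVec, vecMulVec_mulVec, smul_smul]
  have hPw : P.mulVec w = μ • w + ∑ i, (lam i * (star (v i) ⬝ᵥ w)) • u i := by
    rw [← hEw, ← hw, sub_mulVec, sub_add_cancel]
  simp only [mulVec_sub, mulVec_sum, mulVec_smul, hu, hPw, smul_sub, Finset.smul_sum, smul_smul]
  rw [add_sub_assoc, sub_eq_add_neg (μ • w), ← Finset.sum_sub_distrib, ← Finset.sum_neg_distrib]
  congr 1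
  refine Finset.sum_congr rfl fun i _ => ?_
  rw [← sub_smul, ← neg_smul]
  congr 1
  have hi : lam i - μ ≠ 0 := sub_ne_zero.mpr (hμ i).symm
  field_simp
  ring
end

section
/- Let P be an n×n row-stochastic real matrix whose characteristic polynomial over ℂ factors as ∏_{i=1}^n (X − λ_i) with |λ_1| ≥ … ≥ |λ_n|, let γ ∈ [0,1), r ∈ ℂ^n, let s < n, let u_1,…,u_s ∈ ℂ^n satisfy P u_i = λ_i u_i, let v_1,…,v_s ∈ ℂ^n satisfy v_iᴴ u_i = 1 and v_iᴴ u_j = 0 for i ≠ j, and set E_s = ∑_{i=1}^s λ_i u_i v_iᴴ. Then I − γ(P − E_s) is invertible and (I − γ(P − E_s))^{−1} r = (I − γE_s)(I − γP)^{−1} r; equivalently, W* = (I − γE_s) V^π with V^π = (I − γP)^{−1} r is the unique solution of W = r + γ(P − E_s)(I − γE_s)^{−1} W. -/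
open Matrix Polynomial

/-- For a row-stochastic `P` and a discount factor `γ ∈ [0,1)`, the matrix `I - γP` is
invertible, by strict diagonal dominance. -/
theorem isUnit_one_sub_smul_of_row_stochastic {ι : Type*} [Fintype ι] [DecidableEq ι]
    (P : Matrix ι ι ℝ) (hP0 : ∀ x y, 0 ≤ P x y) (hP1 : ∀ x, ∑ y, P x y = 1)
    (γ : ℝ) (hγ0 : 0 ≤ γ) (hγ1 : γ < 1) :
    IsUnit ((1 : Matrix ι ι ℂ) - (γ : ℂ) • P.map (fun t => (t : ℂ))) := by
  rw [Matrix.isUnit_iff_isUnit_det, isUnit_iff_ne_zero]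
  apply det_ne_zero_of_sum_row_lt_diag
  intro k
  have hoff : ∑ j ∈ Finset.univ.erase k,
      ‖((1 : Matrix ι ι ℂ) - (γ : ℂ) • P.map (fun t => (t : ℂ))) k j‖ = γ * (1 - P k k) := by
    rw [← hP1 k, ← Finset.sum_erase_eq_sub (Finset.mem_univ k), Finset.mul_sum]
    refine Finset.sum_congr rfl fun j hj => ?_
    have hkj : k ≠ j := (Finset.ne_of_mem_erase hj).symm
    simp [Matrix.one_apply_ne hkj, abs_of_nonneg hγ0, abs_of_nonneg (hP0 k j)]
  have hdiag : 1 - γ * P k k ≤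
      ‖((1 : Matrix ι ι ℂ) - (γ : ℂ) • P.map (fun t => (t : ℂ))) k k‖ := by
    refine le_trans (le_of_eq ?_) (Complex.re_le_norm _)
    simp
  rw [hoff]
  linarith

/-- If `E = ∑ cᵢ uᵢ wᵢᵀ` with `P uᵢ = cᵢ uᵢ` and `wᵢᵀ uⱼ = δᵢⱼ`, then `P E = E E`. -/
theorem mul_sum_smul_vecMulVec_eq_self_mul {R ι κ : Type*} [CommRing R] [Fintype ι]
    [Fintype κ] [DecidableEq κ] (P : Matrix ι ι R) (c : κ → R) (u w : κ → ι → R)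
    (hu : ∀ i, P *ᵥ u i = c i • u i) (hbi : ∀ i j, w i ⬝ᵥ u j = if i = j then 1 else 0) :
    P * (∑ i, c i • vecMulVec (u i) (w i)) =
      (∑ i, c i • vecMulVec (u i) (w i)) * (∑ i, c i • vecMulVec (u i) (w i)) := by
  have hEu : ∀ j, (∑ i, c i • vecMulVec (u i) (w i)) *ᵥ u j = c j • u j := by
    intro j
    simp [Matrix.sum_mulVec, Matrix.smul_mulVec, Matrix.vecMulVec_mulVec, hbi]
  conv_rhs => rw [Finset.mul_sum]
  rw [Finset.mul_sum]
  refine Finset.sum_congr rfl fun j _ => ?_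
  rw [Matrix.mul_smul, Matrix.mul_smul, Matrix.mul_vecMulVec, Matrix.mul_vecMulVec, hu, hEu]

/-- **The fixed point of the deflated-dynamics `W`-iteration.** For row-stochastic `P`
with deflation matrix `Eₛ = ∑ λᵢ uᵢ vᵢᴴ` and `γ ∈ [0,1)`, the matrix `I - γ(P - Eₛ)` is
invertible with `(I - γ(P-Eₛ))⁻¹ r = (I - γEₛ)(I - γP)⁻¹ r`; equivalently
`W* = (I - γEₛ)V^π` is the unique solution of `W = r + γ(P-Eₛ)(I-γEₛ)⁻¹W`. -/
theorem ddvi_w_iteration_fixed_point {n : ℕ} (P : Matrix (Fin n) (Fin n) ℝ)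
    (hP0 : ∀ x y, 0 ≤ P x y) (hP1 : ∀ x, ∑ y, P x y = 1)
    (Pc : Matrix (Fin n) (Fin n) ℂ) (hPc : Pc = P.map (fun t => (t : ℂ)))
    (lam : Fin n → ℂ)
    (hchar : Pc.charpoly = ∏ i : Fin n, (X - C (lam i)))
    (hord : ∀ i j : Fin n, i ≤ j → ‖lam j‖ ≤ ‖lam i‖)
    (γ : ℝ) (hγ0 : 0 ≤ γ) (hγ1 : γ < 1)
    (r : Fin n → ℂ)
    (s : ℕ) (hs : s < n)
    (u v : Fin s → Fin n → ℂ)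
    (hu : ∀ i : Fin s, Pc.mulVec (u i) = lam (Fin.castLE hs.le i) • u i)
    (hbi : ∀ i j : Fin s, star (v i) ⬝ᵥ u j = if i = j then 1 else 0)
    (E : Matrix (Fin n) (Fin n) ℂ)
    (hE : E = ∑ i : Fin s, lam (Fin.castLE hs.le i) • vecMulVec (u i) (star (v i)))
    (Vpi : Fin n → ℂ)
    (hVpi : Vpi = ((1 : Matrix (Fin n) (Fin n) ℂ) - (γ : ℂ) • Pc)⁻¹.mulVec r)
    (Wstar : Fin n → ℂ)
    (hWstar : Wstar = ((1 : Matrix (Fin n) (Fin n) ℂ) - (γ : ℂ) • E).mulVec Vpi) :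
    IsUnit ((1 : Matrix (Fin n) (Fin n) ℂ) - (γ : ℂ) • (Pc - E)) ∧
      ((1 : Matrix (Fin n) (Fin n) ℂ) - (γ : ℂ) • (Pc - E))⁻¹.mulVec r =
        (((1 : Matrix (Fin n) (Fin n) ℂ) - (γ : ℂ) • E) *
          ((1 : Matrix (Fin n) (Fin n) ℂ) - (γ : ℂ) • Pc)⁻¹).mulVec r ∧
      (Wstar = r + ((γ : ℂ) • ((Pc - E) *
          ((1 : Matrix (Fin n) (Fin n) ℂ) - (γ : ℂ) • E)⁻¹)).mulVec Wstar ∧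
        ∀ W : Fin n → ℂ,
          W = r + ((γ : ℂ) • ((Pc - E) *
              ((1 : Matrix (Fin n) (Fin n) ℂ) - (γ : ℂ) • E)⁻¹)).mulVec W → W = Wstar) := by
  have hA : IsUnit ((1 : Matrix (Fin n) (Fin n) ℂ) - (γ : ℂ) • Pc) :=
    hPc ▸ isUnit_one_sub_smul_of_row_stochastic P hP0 hP1 γ hγ0 hγ1
  have hPE : Pc * E = E * E :=
    hE ▸ mul_sum_smul_vecMulVec_eq_self_mul Pc _ u (fun i => star (v i)) hu hbi
  have hAB : ((γ : ℂ) • Pc) * ((γ : ℂ) • E) = ((γ : ℂ) • E) * ((γ : ℂ) • E) := by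
    simp [hPE]
  rw [← Matrix.smul_mul, hWstar, hVpi, smul_sub]
  generalize (γ : ℂ) • Pc = A at *
  generalize (γ : ℂ) • E = B at *
  have hfac : (1 - (A - B)) * (1 - B) = 1 - A := by
    have : (1 - (A - B)) * (1 - B) = 1 - A + (A * B - B * B) := by noncomm_ring
    rw [this, hAB, sub_self, add_zero]
  have hAdet := (Matrix.isUnit_iff_isUnit_det _).1 hA
  have hdet := hAdet
  rw [← hfac, Matrix.det_mul] at hdet
  have hDdet := isUnit_of_mul_isUnit_left hdet
  have hBdet := isUnit_of_mul_isUnit_right hdet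
  have hinv : (1 - (A - B))⁻¹ = (1 - B) * (1 - A)⁻¹ := by
    apply Matrix.inv_eq_right_inv
    rw [← Matrix.mul_assoc, hfac, Matrix.mul_nonsing_inv _ hAdet]
  have hdyn : (A - B) * (1 - B)⁻¹ = A - B := by
    have h : (A - B) * (1 - B) = A - B := by
      have : (A - B) * (1 - B) = A - B - (A * B - B * B) := by noncomm_ring
      rw [this, hAB, sub_self, sub_zero]
    conv_lhs => rw [← h]
    rw [Matrix.mul_assoc, Matrix.mul_nonsing_inv _ hBdet, Matrix.mul_one]
  have hfix : ∀ W : Fin n → ℂ, W = r + (A - B) *ᵥ W ↔ (1 - (A - B)) *ᵥ W = r := by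
    intro W
    rw [Matrix.sub_mulVec 1 (A - B), Matrix.one_mulVec, sub_eq_iff_eq_add]
  refine ⟨(Matrix.isUnit_iff_isUnit_det _).2 hDdet, by rw [hinv], ?_⟩
  rw [hdyn, Matrix.mulVec_mulVec, ← hinv]
  refine ⟨?_, fun W hW => ?_⟩
  · rw [hfix, Matrix.mulVec_mulVec, Matrix.mul_nonsing_inv _ hDdet, Matrix.one_mulVec]
  · rw [← (hfix W).1 hW, Matrix.mulVec_mulVec, Matrix.nonsing_inv_mul _ hDdet,
      Matrix.one_mulVec]
end
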